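/- Let k ≥ 3 be an integer. For R ≥ 0 and n_0,…,n_R ∈ ℕ, let I_{n_0…n_R} = {β ∈ (k−1, k) : S(n_0…n_{R−1}(n_R+1)000…) ≤ w_β ≤ S(n_0…n_{R−1}n_R∞)} (lexicographic order on Σ). Then these sets are mutually disjoint non-trivial closed subintervals of (k−1, k); their union over all R and all n_0,…,n_R has full Lebesgue measure in (k−1, k); and on each such interval the map β ↦ DF(β) is constant and equal to the convex hull of a finite subset of Δ ∩ ℚ^k. -/

import Mathlib

open Filter Topology
open scoped Classical

namespace BetaDF

/-- Digit sequences (elements of `Σ = {0,…,k−1}^ℕ` when all entries are `< k`). -/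
abbrev Seq : Type := ℕ → ℕ

/-- Lexicographic (strict) order on digit sequences. -/
def seqLt (v w : Seq) : Prop := ∃ r, (∀ s, s < r → v s = w s) ∧ v r < w r

/-- Lexicographic order on digit sequences. -/
def seqLe (v w : Seq) : Prop := seqLt v w ∨ v = w

/-- The shift map `σ`. -/
def shift (w : Seq) : Seq := fun r => w (r + 1)

/-- Membership in `Σ = {0,…,k−1}^ℕ`. -/
def InSigma (k : ℕ) (w : Seq) : Prop := ∀ r, w r < k

/-- A sequence is maximal if it is `≥` every element of its shift orbit. -/
def IsMaximal (w : Seq) : Prop := ∀ r, seqLe (shift^[r] w) w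

/-- Number of occurrences of the digit `i` among the first `r` entries of `w`. -/
def digitCount (w : Seq) (i r : ℕ) : ℕ := ((Finset.range r).filter fun s => w s = i).card

/-- The ambient Euclidean space `ℝ^k`. -/
abbrev E (k : ℕ) : Type := EuclideanSpace ℝ (Fin k)

/-- The `i`-th coordinate (with junk value `0` for `i ≥ k`). -/
def proj {k : ℕ} (α : E k) (i : ℕ) : ℝ := if h : i < k then α ⟨i, h⟩ else 0

/-- `w` has digit frequency vector `α`. -/
def HasDigitFreq (k : ℕ) (w : Seq) (α : E k) : Prop :=
  ∀ i, i < k →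
    Tendsto (fun r => (digitCount w i r : ℝ) / (r : ℝ)) atTop (𝓝 (proj α i))

/-- The standard `(k−1)`-simplex `Δ`. -/
def simplex (k : ℕ) : Set (E k) := {α | (∀ i : Fin k, 0 ≤ α i) ∧ ∑ i, α i = 1}

/-- The face `F = {α ∈ Δ : α_{k−1} = 0}`. -/
def faceF (k : ℕ) : Set (E k) := {α ∈ simplex k | proj α (k - 1) = 0}

/-- `Δ' = Δ ∖ F`. -/
def simplex' (k : ℕ) : Set (E k) := simplex k \ faceF k

/-- `J(α) = ⌊α₀/α_{k−1}⌋`. -/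
noncomputable def Jfun {k : ℕ} (α : E k) : ℕ := ⌊proj α 0 / proj α (k - 1)⌋₊

/-- The map `K_n`. -/
noncomputable def Kmap {k : ℕ} (n : ℕ) (α : E k) : E k :=
  (WithLp.equiv 2 (Fin k → ℝ)).symm fun i =>
    if (i : ℕ) + 2 < k then proj α ((i : ℕ) + 1) / (1 - proj α 0)
    else if (i : ℕ) + 2 = k then (proj α 0 - n * proj α (k - 1)) / (1 - proj α 0)
    else ((n + 1) * proj α (k - 1) - proj α 0) / (1 - proj α 0)

/-- The continued-fraction map `K : Δ' → Δ'`, `K(α) = K_{J(α)}(α)`. -/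
noncomputable def Kstep {k : ℕ} (α : E k) : E k := Kmap (Jfun α) α

/-- The itinerary map `Φ(α)_r = J(K^r(α))`. -/
noncomputable def Phi {k : ℕ} (α : E k) : ℕ → ℕ := fun r => Jfun (Kstep^[r] α)

/-- The projective embedding `K_n^{-1} : Δ → Δ`. -/
noncomputable def Kinv {k : ℕ} (n : ℕ) (α : E k) : E k :=
  (WithLp.equiv 2 (Fin k → ℝ)).symm fun i =>
    (if (i : ℕ) = 0 then (n + 1) * proj α (k - 2) + n * proj α (k - 1)
      else if (i : ℕ) + 1 = k then proj α (k - 2) + proj α (k - 1)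
      else proj α ((i : ℕ) - 1)) /
      ((n + 1) * proj α (k - 2) + n * proj α (k - 1) + 1)

/-- `Υ_{n,r} = K_{n₀}^{-1} ∘ ⋯ ∘ K_{n_r}^{-1}`. -/
noncomputable def Ups {k : ℕ} (n : ℕ → ℕ) : ℕ → E k → E k
  | 0 => Kinv (n 0)
  | r + 1 => fun α => Ups n r (Kinv (n (r + 1)) α)

/-- `A_{n,r} = Υ_{n,r}(Δ)`. -/
noncomputable def Anr (k : ℕ) (n : ℕ → ℕ) (r : ℕ) : Set (E k) := Ups n r '' simplex k

/-- `F_{n,r} = Υ_{n,r}(F)`. -/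
noncomputable def Fnr (k : ℕ) (n : ℕ → ℕ) (r : ℕ) : Set (E k) := Ups n r '' faceF k

/-- Reverse-lexicographic strict order on `ℕ^ℕ`: `a < b` iff `a` exceeds `b`
at the first index where they differ. -/
def revLexLt (a b : ℕ → ℕ) : Prop := ∃ r, (∀ s, s < r → a s = b s) ∧ b r < a r

/-- The word to which the substitution `Λ_n` sends the digit `i`. -/
def lamWord (k n i : ℕ) : List ℕ :=
  if i + 2 < k then [i + 1]
  else if i + 2 = k then (k - 1) :: List.replicate (n + 1) 0
  else (k - 1) :: List.replicate n 0

/-- The substitution `Λ_n : Σ → Σ`. -/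
def lamSub (k n : ℕ) (w : Seq) : Seq := fun m =>
  (((List.range (m + 1)).map fun r => lamWord k n (w r)).flatten).getD m 0

/-- `Λ_{n,r} = Λ_{n₀} ∘ ⋯ ∘ Λ_{n_r}`. -/
def lamChain (k : ℕ) (n : ℕ → ℕ) : ℕ → Seq → Seq
  | 0 => lamSub k (n 0)
  | r + 1 => fun w => lamChain k n r (lamSub k (n (r + 1)) w)

/-- `Λ_{n₀} ∘ ⋯ ∘ Λ_{n_{R−1}}` for a finite list of indices. -/
def lamList (k : ℕ) : List ℕ → Seq → Seq
  | [], w => w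
  | a :: t, w => lamSub k a (lamList k t w)

/-- The constant sequence `(k−1)(k−1)(k−1)…`. -/
def topSeq (k : ℕ) : Seq := fun _ => k - 1

/-- The sequence `(k−1)000…`. -/
def baseSeq (k : ℕ) : Seq := fun m => if m = 0 then k - 1 else 0

/-- `S(n) = lim_{r→∞} Λ_{n,r}((k−1)(k−1)(k−1)…)` (limit in the product topology). -/
noncomputable def Sseq (k : ℕ) (n : ℕ → ℕ) : Seq :=
  limUnder atTop fun r => lamChain k n r (topSeq k)

/-- The compactified itinerary space `N`: sequences with values in `ℕ∞` such that
all entries from the first `∞` onwards equal `∞`.  Elements with no `∞` entry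
correspond to `ℕ^ℕ`; the others are the finite type elements `n₀…n_{R−1}∞`. -/
def NN : Type := {m : ℕ → ℕ∞ // ∀ r, m r = ⊤ → m (r + 1) = ⊤}

/-- Reverse-lexicographic strict order on `N` (`∞` counts as larger than every natural). -/
def nnLt (m n : NN) : Prop := ∃ r, (∀ s, s < r → m.1 s = n.1 s) ∧ n.1 r < m.1 r

/-- Reverse-lexicographic order on `N`. -/
def nnLe (m n : NN) : Prop := nnLt m n ∨ m = n

/-- The element of `N` determined by an element of `ℕ^ℕ`. -/
def toNN (g : ℕ → ℕ) : NN := ⟨fun r => (g r : ℕ∞), fun r h => absurd h (by simp)⟩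

/-- The itinerary `n₀ … n_{R−1} (n_R + 1) 0 0 0 …` (of rational type). -/
def ratSeq (f : ℕ → ℕ) (R : ℕ) : ℕ → ℕ := fun r =>
  if r < R then f r else if r = R then f R + 1 else 0

/-- The finite type element `n₀ … n_{R−1} n_R ∞` of `N`. -/
def finNN (f : ℕ → ℕ) (R : ℕ) : NN :=
  ⟨fun r => if r ≤ R then (f r : ℕ∞) else ⊤, by
    intro r h
    show (if r + 1 ≤ R then ((f (r + 1) : ℕ∞)) else ⊤) = ⊤
    have h' : (if r ≤ R then ((f r : ℕ∞)) else ⊤) = ⊤ := h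
    by_cases h1 : r ≤ R
    · rw [if_pos h1] at h'
      exact absurd h' (by simp)
    · rw [if_neg (by omega : ¬ r + 1 ≤ R)]⟩

/-- The extension of `S` to `N`. -/
noncomputable def SN (k : ℕ) (m : NN) : Seq :=
  if h : ∃ R, m.1 R = ⊤ then
    lamList k ((List.range (Nat.find h)).map fun r => (m.1 r).toNat) (baseSeq k)
  else Sseq k fun r => (m.1 r).toNat

/-- The metric `d(m,n) = 2^{−X(m,n)}` on `N`, where
`X(m,n) = r + min(m₀+⋯+m_r, n₀+⋯+n_r)` and `r` is the first index where `m,n` differ. -/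
noncomputable def dN (m n : NN) : ℝ :=
  if h : m = n then 0
  else
    have hex : ∃ r, m.1 r ≠ n.1 r := by
      by_contra hc
      push_neg at hc
      exact h (Subtype.ext (funext hc))
    (2 : ℝ) ^ (-(((Nat.find hex : ℕ) : ℤ) +
      ((min (∑ s ∈ Finset.range (Nat.find hex + 1), m.1 s)
            (∑ s ∈ Finset.range (Nat.find hex + 1), n.1 s)).toNat : ℤ)))

/-- The symbolic β-shift `X(w)`. -/
def Xset (k : ℕ) (w : Seq) : Set Seq :=
  {v | InSigma k v ∧ ∀ r, seqLe (shift^[r] v) w}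

/-- The digit frequency set `DF(w)` of the symbolic β-shift `X(w)`. -/
def DFw (k : ℕ) (w : Seq) : Set (E k) :=
  {α | α ∈ simplex k ∧ ∃ v ∈ Xset k w, HasDigitFreq k v α}

/-- `DF(n) = DF(S(n))` for `n ∈ ℕ^ℕ`. -/
noncomputable def DFn (k : ℕ) (n : ℕ → ℕ) : Set (E k) := DFw k (Sseq k n)

/-- `DF(n) = DF(S(n))` for `n ∈ N`. -/
noncomputable def DFN (k : ℕ) (m : NN) : Set (E k) := DFw k (SN k m)

/-- The infimax map `I = S ∘ Φ` on `Δ'`, extended by `I(α) = (k−1)000…` on `F`. -/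
noncomputable def Ifun (k : ℕ) (α : E k) : Seq :=
  if α ∈ simplex' k then Sseq k (Phi α) else baseSeq k

/-- The simplex `T_m = {α ∈ Δ : (m+1)α_{k−1} ≤ α₀}`. -/
def Tset (k m : ℕ) : Set (E k) :=
  {α ∈ simplex k | ((m : ℝ) + 1) * proj α (k - 1) ≤ proj α 0}

/-- The standard basis vector `e_i`. -/
noncomputable def evec (k i : ℕ) : E k :=
  (WithLp.equiv 2 (Fin k → ℝ)).symm fun j => if (j : ℕ) = i then 1 else 0

/-- The rational extreme points
`FE(n) = {Υ_{n,s}(e_{k−2}) : n_{s+t} ≠ 0 for some 1 ≤ t ≤ k−2}`. -/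
noncomputable def FEset (k : ℕ) (n : ℕ → ℕ) : Set (E k) :=
  {α | ∃ s, (∃ t, 1 ≤ t ∧ t ≤ k - 2 ∧ n (s + t) ≠ 0) ∧ α = Ups n s (evec k (k - 2))}

/-- The set `E(n)` of non-trivial extreme points of `DF(n)`:
extreme points other than `e₀,…,e_{k−2}`. -/
noncomputable def Eset (k : ℕ) (n : ℕ → ℕ) : Set (E k) :=
  Set.extremePoints ℝ (DFn k n) \ {α | ∃ i, i ≤ k - 2 ∧ α = evec k i}

/-- The fiber `Φ^{-1}(n) ⊆ Δ'`. -/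
noncomputable def PhiFiber (k : ℕ) (n : ℕ → ℕ) : Set (E k) :=
  {α ∈ simplex' k | Phi α = n}

/-- `f_β(x) = βx mod 1`. -/
noncomputable def fbeta (β x : ℝ) : ℝ := Int.fract (β * x)

/-- The digit sequence of the greedy β-expansion of `x`: `d_β(x)_r = ⌊β f_β^r(x)⌋`. -/
noncomputable def dbeta (β : ℝ) (x : ℝ) : Seq := fun r => ⌊β * (fbeta β)^[r] x⌋₊

/-- The digit frequency set `DF(β)` of β-expansions of points of `[0,1]`. -/
noncomputable def DFbeta (k : ℕ) (β : ℝ) : Set (E k) :=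
  {α | α ∈ simplex k ∧ ∃ x ∈ Set.Icc (0 : ℝ) 1, HasDigitFreq k (dbeta β x) α}

/-- The sequence `w_β`: if `d_β(1) = d₁…d_{r−1}d_r000…` with `d_r > 0` then `w_β`
is the infinite repetition of `d₁…d_{r−1}(d_r − 1)`; otherwise `w_β = d_β(1)`. -/
noncomputable def wbeta (β : ℝ) : Seq :=
  if h : ∃ r, dbeta β 1 r ≠ 0 ∧ ∀ s, r < s → dbeta β 1 s = 0 then
    fun m =>
      if m % (Nat.find h + 1) = Nat.find h then dbeta β 1 (Nat.find h) - 1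
      else dbeta β 1 (m % (Nat.find h + 1))
  else dbeta β 1

/-- `DF` extended to `[k−1,k]` by `DF(k−1) = F` and `DF(k) = Δ`. -/
noncomputable def DFext (k : ℕ) (β : ℝ) : Set (E k) :=
  if β ≤ (k : ℝ) - 1 then faceF k
  else if (k : ℝ) ≤ β then simplex k
  else DFbeta k β

/-- The mode-locking interval `I_{n₀…n_R}` determined by the word `f 0, …, f R`. -/
noncomputable def Iint (k : ℕ) (f : ℕ → ℕ) (R : ℕ) : Set ℝ :=
  {β | (k : ℝ) - 1 < β ∧ β < k ∧
    seqLe (Sseq k (ratSeq f R)) (wbeta β) ∧ seqLe (wbeta β) (SN k (finNN f R))}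

/-- The frequency vector of the first `s` digits of `w`. -/
noncomputable def freqVec (k : ℕ) (w : Seq) (s : ℕ) : E k :=
  (WithLp.equiv 2 (Fin k → ℝ)).symm fun i => (digitCount w (i : ℕ) s : ℝ) / (s : ℝ)



/-! ### Lexicographic order -/

theorem seqLt_iff {v w : Seq} : seqLt v w ↔ toLex v < toLex w := Iff.rfl

theorem seqLe_iff {v w : Seq} : seqLe v w ↔ toLex v ≤ toLex w :=
  (le_iff_lt_or_eq (a := (toLex v : Lex (ℕ → ℕ))) (b := toLex w)).symm

theorem seqLt_trans {u v w : Seq} (h : seqLt u v) (h' : seqLt v w) : seqLt u w := by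
  rw [seqLt_iff] at *; exact h.trans h'

theorem seqLe_trans {u v w : Seq} (h : seqLe u v) (h' : seqLe v w) : seqLe u w := by
  rw [seqLe_iff] at *; exact h.trans h'

theorem seqLt_of_le_of_lt {u v w : Seq} (h : seqLe u v) (h' : seqLt v w) : seqLt u w := by
  rw [seqLe_iff] at h; rw [seqLt_iff] at *; exact h.trans_lt h'

theorem seqLt_of_lt_of_le {u v w : Seq} (h : seqLt u v) (h' : seqLe v w) : seqLt u w := by
  rw [seqLe_iff] at h'; rw [seqLt_iff] at *; exact h.trans_le h'

theorem seqLt_irrefl {v : Seq} : ¬ seqLt v v := by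
  rw [seqLt_iff]; exact lt_irrefl _

theorem not_seqLe {v w : Seq} : ¬ seqLe v w ↔ seqLt w v := by
  rw [seqLe_iff]; exact not_le (α := Lex (ℕ → ℕ))

theorem not_seqLt {v w : Seq} : ¬ seqLt v w ↔ seqLe w v := by
  rw [seqLe_iff]; exact not_lt (α := Lex (ℕ → ℕ))

theorem seqLe_refl (v : Seq) : seqLe v v := Or.inr rfl

theorem seqLe_of_head {v w : Seq} (h : v 0 < w 0) : seqLt v w :=
  ⟨0, fun s hs => absurd hs (by omega), h⟩

theorem seqLt_trichotomy (v w : Seq) : seqLt v w ∨ v = w ∨ seqLt w v := by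
  rcases lt_trichotomy (toLex v) (toLex w) with h | h | h
  · exact Or.inl h
  · exact Or.inr (Or.inl h)
  · exact Or.inr (Or.inr h)

/-- Agreement on the first `g` entries. -/
def agree (g : ℕ) (x y : Seq) : Prop := ∀ m, m < g → x m = y m

theorem agree.symm {g : ℕ} {x y : Seq} (h : agree g x y) : agree g y x := fun m hm => (h m hm).symm
theorem agree.trans {g : ℕ} {x y z : Seq} (h : agree g x y) (h' : agree g y z) : agree g x z :=
  fun m hm => (h m hm).trans (h' m hm)
theorem agree.mono {g g' : ℕ} {x y : Seq} (h : agree g x y) (hg : g' ≤ g) : agree g' x y :=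
  fun m hm => h m (by omega)

theorem agree_squeeze {g : ℕ} {x w y : Seq} (h : agree g x y) (h1 : seqLe x w) (h2 : seqLe w y) :
    agree g w y := by
  rcases h2 with ⟨r, hr, hlt⟩ | rfl
  · by_cases hrg : g ≤ r
    · exact fun m hm => hr m (by omega)
    · exfalso
      push Not at hrg
      have : seqLt w x := ⟨r, fun s hs => (hr s hs).trans (h s (by omega)).symm, by
        rw [h r hrg]; exact hlt⟩
      exact seqLt_irrefl (seqLt_of_le_of_lt h1 this)
  · exact fun _ _ => rfl

theorem shift_iter (r : ℕ) (w : Seq) : shift^[r] w = fun m => w (m + r) := by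
  induction r generalizing w with
  | zero => rfl
  | succ r ih =>
    rw [Function.iterate_succ_apply, ih]
    funext m
    simp only [shift]
    congr 1

theorem shift_iter_apply (r : ℕ) (w : Seq) (m : ℕ) : (shift^[r] w) m = w (m + r) := by
  rw [shift_iter]

/-! ### Concatenation of blocks -/

/-- prefix a list to a sequence -/
def app (l : List ℕ) (w : Seq) : Seq := fun m => l.getD m (w (m - l.length))

theorem app_lt (l : List ℕ) (w : Seq) {m : ℕ} (h : m < l.length) : app l w m = l[m] := by
  simp [app, h]

theorem app_ge (l : List ℕ) (w : Seq) (m : ℕ) : app l w (l.length + m) = w m := by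
  simp [app]

theorem app_ge' (l : List ℕ) (w : Seq) {m : ℕ} (h : l.length ≤ m) :
    app l w m = w (m - l.length) := by
  obtain ⟨j, rfl⟩ := Nat.exists_eq_add_of_le h
  rw [app_ge]; simp

theorem app_shift (l : List ℕ) (w : Seq) : shift^[l.length] (app l w) = w := by
  rw [shift_iter]; funext m
  rw [Nat.add_comm, app_ge]

theorem app_append (l l' : List ℕ) (w : Seq) : app (l ++ l') w = app l (app l' w) := by
  funext m
  by_cases h : m < l.length
  · rw [app_lt _ _ (by simp; omega), app_lt _ _ h]; simp [h]
  · push Not at h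
    obtain ⟨j, rfl⟩ := Nat.exists_eq_add_of_le h
    rw [app_ge]
    by_cases h' : j < l'.length
    · rw [app_lt _ _ (by simp; omega), app_lt _ _ h']; simp
    · push Not at h'
      obtain ⟨i, rfl⟩ := Nat.exists_eq_add_of_le h'
      rw [app_ge, ← Nat.add_assoc, ← List.length_append, app_ge]

/-- the concatenation of a sequence of blocks -/
def cat (B : ℕ → List ℕ) : Seq := fun m =>
  (((List.range (m + 1)).map B).flatten).getD m 0

theorem lamSub_eq (k n : ℕ) (w : Seq) : lamSub k n w = cat (fun r => lamWord k n (w r)) := rfl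

/-- start position of block `q` -/
def pos (B : ℕ → List ℕ) (q : ℕ) : ℕ := ∑ j ∈ Finset.range q, (B j).length

theorem pos_succ (B : ℕ → List ℕ) (q : ℕ) : pos B (q + 1) = pos B q + (B q).length :=
  Finset.sum_range_succ _ _

theorem pos_zero (B : ℕ → List ℕ) : pos B 0 = 0 := rfl

theorem length_flatten (B : ℕ → List ℕ) (q : ℕ) :
    (((List.range q).map B).flatten).length = pos B q := by
  induction q with
  | zero => rfl
  | succ q ih =>
    rw [List.range_succ, List.map_append, List.flatten_append, List.length_append, ih, pos_succ]
    simp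

theorem le_pos {B : ℕ → List ℕ} (hB : ∀ j, B j ≠ []) (q : ℕ) : q ≤ pos B q := by
  induction q with
  | zero => simp
  | succ q ih =>
    rw [pos_succ]
    have := List.length_pos_of_ne_nil (hB q)
    omega

theorem flatten_getD_mono (B : ℕ → List ℕ) {q q' m : ℕ} (hq : q ≤ q') (hm : m < pos B q) :
    (((List.range q').map B).flatten).getD m 0 = (((List.range q).map B).flatten).getD m 0 := by
  induction q', hq using Nat.le_induction with
  | base => rfl
  | succ p hp ih =>
    rw [← ih, List.range_succ, List.map_append, List.flatten_append]
    rw [List.getD_append]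
    rw [length_flatten]
    have : pos B q ≤ pos B p := Finset.sum_le_sum_of_subset (by simpa using hp)
    omega

theorem cat_pos {B : ℕ → List ℕ} (hB : ∀ j, B j ≠ []) (q j : ℕ) (hj : j < (B q).length) :
    cat B (pos B q + j) = (B q)[j] := by
  have h1 := le_pos hB q
  have : cat B (pos B q + j) = (((List.range (q+1)).map B).flatten).getD (pos B q + j) 0 := by
    unfold cat
    apply flatten_getD_mono
    · omega
    · rw [pos_succ]; omega
  rw [this, List.range_succ, List.map_append, List.flatten_append, List.getD_append_right]
  · rw [length_flatten]
    simp [hj]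
  · rw [length_flatten]; omega

theorem exists_pos {B : ℕ → List ℕ} (hB : ∀ j, B j ≠ []) (m : ℕ) :
    ∃ q j, j < (B q).length ∧ m = pos B q + j := by
  induction m with
  | zero => exact ⟨0, 0, List.length_pos_of_ne_nil (hB 0), rfl⟩
  | succ m ih =>
    obtain ⟨q, j, hj, rfl⟩ := ih
    by_cases h : j + 1 < (B q).length
    · exact ⟨q, j+1, h, rfl⟩
    · exact ⟨q+1, 0, List.length_pos_of_ne_nil (hB _), by rw [pos_succ]; omega⟩

theorem pos_shift (B : ℕ → List ℕ) (q j : ℕ) :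
    pos B (q + j) = pos B q + pos (fun i => B (i + q)) j := by
  induction j with
  | zero => rfl
  | succ j ih => rw [← Nat.add_assoc, pos_succ, pos_succ, ih, Nat.add_assoc, Nat.add_comm j q]

theorem cat_shift {B : ℕ → List ℕ} (hB : ∀ j, B j ≠ []) (q : ℕ) :
    shift^[pos B q] (cat B) = cat (fun i => B (i + q)) := by
  funext m
  rw [shift_iter_apply]
  obtain ⟨p, j, hj, rfl⟩ := exists_pos (B := fun i => B (i + q)) (fun _ => hB _) m
  rw [cat_pos (B := fun i => B (i + q)) (fun _ => hB _) p j hj]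
  have := cat_pos hB (q + p) j (by rw [Nat.add_comm q p]; exact hj)
  rw [pos_shift] at this
  rw [show pos (fun i => B (i + q)) p + j + pos B q = pos B q + pos (fun i => B (i + q)) p + j by omega,
    this]
  simp [Nat.add_comm q p]

theorem cat_cons {B : ℕ → List ℕ} (hB : ∀ j, B j ≠ []) :
    cat B = app (B 0) (cat (fun i => B (i + 1))) := by
  funext m
  by_cases h : m < (B 0).length
  · rw [app_lt _ _ h]
    have := cat_pos hB 0 m h
    rw [pos_zero, Nat.zero_add] at this
    exact this
  · push Not at h
    obtain ⟨j, rfl⟩ := Nat.exists_eq_add_of_le h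
    rw [app_ge, ← cat_shift hB 1, shift_iter_apply, pos_succ, pos_zero]
    congr 1; omega

theorem cat_agree {B B' : ℕ → List ℕ} (hB : ∀ j, B j ≠ []) (hB' : ∀ j, B' j ≠ []) {g : ℕ}
    (h : ∀ j, j < g → B j = B' j) : pos B g = pos B' g ∧ agree (pos B g) (cat B) (cat B') := by
  have hp : ∀ q, q ≤ g → pos B q = pos B' q := fun q hq =>
    Finset.sum_congr rfl fun j hj => by rw [h j (by simp at hj; omega)]
  refine ⟨hp g le_rfl, fun m hm => ?_⟩
  obtain ⟨q, j, hj, rfl⟩ := exists_pos hB m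
  have hq : q < g := by
    by_contra hc
    have : pos B g ≤ pos B q := Finset.sum_le_sum_of_subset (by simpa using hc)
    omega
  rw [cat_pos hB q j hj]
  have := cat_pos hB' q j (by rw [← h q hq]; exact hj)
  rw [hp q hq.le, this]
  simp [h q hq]

/-- coinduction principle for the lexicographic order -/
theorem seqLe_coind (Rel : Seq → Seq → Prop)
    (h : ∀ a b, Rel a b → seqLt a b ∨ ∃ l : List ℕ, l ≠ [] ∧ ∃ a' b', a = app l a' ∧ b = app l b' ∧
      Rel a' b') {a b : Seq} (hab : Rel a b) : seqLe a b := by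
  by_contra hc
  rw [not_seqLe] at hc
  obtain ⟨r, h1, h2⟩ := hc
  induction r using Nat.strong_induction_on generalizing a b with
  | _ r ih =>
    rcases h a b hab with hlt | ⟨l, hl, a', b', rfl, rfl, hR⟩
    · exact seqLt_irrefl (seqLt_trans hlt ⟨r, h1, h2⟩)
    · have hl' := List.length_pos_of_ne_nil hl
      by_cases hr : r < l.length
      · rw [app_lt _ _ hr, app_lt _ _ hr] at h2; omega
      · push Not at hr
        obtain ⟨j, rfl⟩ := Nat.exists_eq_add_of_le hr
        rw [app_ge, app_ge] at h2
        refine ih j (by omega) hR (fun s hs => ?_) h2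
        have := h1 (l.length + s) (by omega)
        rwa [app_ge, app_ge] at this

/-! ### The substitutions -/

theorem lamWord_ne_nil (k n i : ℕ) : lamWord k n i ≠ [] := by
  unfold lamWord; split_ifs <;> simp

theorem lamWord_len_pos (k n i : ℕ) : 0 < (lamWord k n i).length :=
  List.length_pos_of_ne_nil (lamWord_ne_nil k n i)

theorem lamWord_lo {k n i : ℕ} (h : i + 2 < k) : lamWord k n i = [i + 1] := by
  simp [lamWord, h]

theorem lamWord_mid {k n i : ℕ} (h : i + 2 = k) :
    lamWord k n i = (k - 1) :: List.replicate (n + 1) 0 := by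
  simp [lamWord, h]

theorem lamWord_hi {k n i : ℕ} (h : k < i + 2) :
    lamWord k n i = (k - 1) :: List.replicate n 0 := by
  unfold lamWord
  rw [if_neg (by omega), if_neg (by omega)]

theorem lamWord_head {k n i : ℕ} :
    (lamWord k n i)[0]'(lamWord_len_pos k n i) = if i + 2 < k then i + 1 else k - 1 := by
  unfold lamWord
  split_ifs <;> simp

/-- start position of block `q` in `Λ_n w` -/
def lpos (k n : ℕ) (w : Seq) (q : ℕ) : ℕ := pos (fun r => lamWord k n (w r)) q

theorem lam_at (k n : ℕ) (w : Seq) (q j : ℕ) (hj : j < (lamWord k n (w q)).length) :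
    lamSub k n w (lpos k n w q + j) = (lamWord k n (w q))[j] :=
  cat_pos (B := fun r => lamWord k n (w r)) (fun _ => lamWord_ne_nil _ _ _) q j hj

theorem le_lpos (k n : ℕ) (w : Seq) (q : ℕ) : q ≤ lpos k n w q :=
  le_pos (fun _ => lamWord_ne_nil _ _ _) q

theorem lpos_succ (k n : ℕ) (w : Seq) (q : ℕ) :
    lpos k n w (q + 1) = lpos k n w q + (lamWord k n (w q)).length := pos_succ _ q

theorem lam_exists (k n : ℕ) (w : Seq) (m : ℕ) :
    ∃ q j, j < (lamWord k n (w q)).length ∧ m = lpos k n w q + j :=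
  exists_pos (B := fun r => lamWord k n (w r)) (fun _ => lamWord_ne_nil _ _ _) m

theorem lam_shift (k n : ℕ) (w : Seq) (q : ℕ) :
    shift^[lpos k n w q] (lamSub k n w) = lamSub k n (shift^[q] w) := by
  rw [lamSub_eq, lamSub_eq, lpos, cat_shift (fun _ => lamWord_ne_nil _ _ _), shift_iter]

theorem lam_cons (k n : ℕ) (w : Seq) :
    lamSub k n w = app (lamWord k n (w 0)) (lamSub k n (shift w)) := by
  rw [lamSub_eq, lamSub_eq, cat_cons (fun _ => lamWord_ne_nil _ _ _)]; rfl

theorem lam_agree {k n g : ℕ} {x y : Seq} (h : agree g x y) :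
    lpos k n x g = lpos k n y g ∧ agree (lpos k n x g) (lamSub k n x) (lamSub k n y) := by
  refine cat_agree (fun _ => lamWord_ne_nil _ _ _) (fun _ => lamWord_ne_nil _ _ _) ?_
  intro j hj; rw [h j hj]

theorem lam_agree' {k n g : ℕ} {x y : Seq} (h : agree g x y) :
    agree g (lamSub k n x) (lamSub k n y) :=
  (lam_agree (n := n) h).2.mono (le_lpos k n x g)

theorem lam_head_at (k n : ℕ) (w : Seq) (q : ℕ) :
    lamSub k n w (lpos k n w q) = if w q + 2 < k then w q + 1 else k - 1 := by
  have := lam_at k n w q 0 (lamWord_len_pos _ _ _)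
  rw [Nat.add_zero, lamWord_head] at this
  exact this

theorem lam_head_pos {k : ℕ} (hk : 3 ≤ k) (n : ℕ) (w : Seq) (q : ℕ) :
    0 < lamSub k n w (lpos k n w q) := by
  rw [lam_head_at]; split_ifs <;> omega

theorem lam_zero (k n : ℕ) (w : Seq) :
    lamSub k n w 0 = if w 0 + 2 < k then w 0 + 1 else k - 1 := lam_head_at k n w 0

theorem lam_insigma {k : ℕ} (hk : 3 ≤ k) (n : ℕ) (w : Seq) : InSigma k (lamSub k n w) := by
  intro m
  obtain ⟨q, j, hj, rfl⟩ := lam_exists k n w m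
  rw [lam_at _ _ _ _ _ hj]
  have hm : (lamWord k n (w q))[j] ∈ lamWord k n (w q) := List.getElem_mem _
  generalize (lamWord k n (w q))[j] = d at *
  unfold lamWord at hm
  split_ifs at hm <;> simp at hm <;> omega

/-- The quantitative form of strict monotonicity of `Λ_n`. -/
theorem lam_step {k : ℕ} (hk : 3 ≤ k) (n : ℕ) {x y : Seq} (hy : InSigma k y)
    {g : ℕ} (h : agree g x y) (hlt : x g < y g) :
    ∃ g', agree g' (lamSub k n x) (lamSub k n y) ∧ lamSub k n x g' < lamSub k n y g' ∧
      k * g + x g + 1 ≤ k * g' + lamSub k n x g' := by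
  obtain ⟨hp, ha⟩ := lam_agree (n := n) h
  have hyg := hy g
  have hle := le_lpos k n x g
  have hkle : k * g ≤ k * lpos k n x g := Nat.mul_le_mul_left _ hle
  by_cases hx : x g + 2 < k
  · refine ⟨lpos k n x g, ha, ?_, ?_⟩
    · rw [lam_head_at, hp, lam_head_at]; split_ifs <;> omega
    · rw [lam_head_at, if_pos hx]; omega
  · have hxg : x g + 2 = k := by omega
    have hyg' : k < y g + 2 := by omega
    have hxw : lamWord k n (x g) = (k - 1) :: List.replicate (n + 1) 0 := lamWord_mid hxg
    have hyw : lamWord k n (y g) = (k - 1) :: List.replicate n 0 := lamWord_hi hyg'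
    have hX : lamSub k n x (lpos k n x g + (n + 1)) = 0 := by
      rw [lam_at _ _ _ _ _ (by rw [hxw]; simp)]; simp [hxw]
    have hY : 0 < lamSub k n y (lpos k n x g + (n + 1)) := by
      have := lam_head_pos hk n y (g + 1)
      rw [lpos_succ, hyw, ← hp] at this
      simpa using this
    refine ⟨lpos k n x g + (n + 1), ?_, by omega, ?_⟩
    · intro m hm
      by_cases hm' : m < lpos k n x g
      · exact ha m hm'
      · push Not at hm'
        obtain ⟨j, rfl⟩ := Nat.exists_eq_add_of_le hm'
        rw [lam_at _ _ _ _ _ (by rw [hxw]; simp; omega), hp,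
          lam_at _ _ _ _ _ (by rw [hyw]; simp; omega)]
        simp only [hxw, hyw]
        rcases j with _ | j
        · simp
        · simp
    · rw [hX, mul_add, mul_add]; omega

theorem lam_strictMono {k : ℕ} (hk : 3 ≤ k) (n : ℕ) {x y : Seq} (hy : InSigma k y)
    (h : seqLt x y) : seqLt (lamSub k n x) (lamSub k n y) := by
  obtain ⟨g, h1, h2⟩ := h
  obtain ⟨g', h1', h2', _⟩ := lam_step hk n hy h1 h2
  exact ⟨g', h1', h2'⟩

theorem lam_mono {k : ℕ} (hk : 3 ≤ k) (n : ℕ) {x y : Seq} (hy : InSigma k y)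
    (h : seqLe x y) : seqLe (lamSub k n x) (lamSub k n y) := by
  rcases h with h | rfl
  · exact Or.inl (lam_strictMono hk n hy h)
  · exact seqLe_refl _

theorem lam_reflect {k : ℕ} (hk : 3 ≤ k) (n : ℕ) {x y : Seq} (hx : InSigma k x)
    (h : seqLe (lamSub k n x) (lamSub k n y)) : seqLe x y := by
  by_contra hc
  rw [not_seqLe] at hc
  exact seqLt_irrefl (seqLt_of_le_of_lt h (lam_strictMono hk n hx hc))

theorem insigma_shift {k : ℕ} {w : Seq} (h : InSigma k w) (r : ℕ) : InSigma k (shift^[r] w) := by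
  intro m; rw [shift_iter_apply]; exact h _

/-! ### `lamList` -/

theorem lamList_append (k : ℕ) (l l' : List ℕ) (w : Seq) :
    lamList k (l ++ l') w = lamList k l (lamList k l' w) := by
  induction l with
  | nil => rfl
  | cons a t ih => simp only [List.cons_append, lamList, ih]

theorem lamList_insigma {k : ℕ} (hk : 3 ≤ k) (l : List ℕ) {w : Seq} (hw : InSigma k w) :
    InSigma k (lamList k l w) := by
  cases l with
  | nil => exact hw
  | cons a t => exact lam_insigma hk _ _

theorem lamList_strictMono {k : ℕ} (hk : 3 ≤ k) (l : List ℕ) {x y : Seq} (hy : InSigma k y)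
    (h : seqLt x y) : seqLt (lamList k l x) (lamList k l y) := by
  induction l with
  | nil => exact h
  | cons a t ih => exact lam_strictMono hk a (lamList_insigma hk t hy) ih

theorem lamList_agree {k g : ℕ} (l : List ℕ) {x y : Seq} (h : agree g x y) :
    agree g (lamList k l x) (lamList k l y) := by
  induction l with
  | nil => exact h
  | cons a t ih => exact lam_agree' ih

theorem lamList_step {k : ℕ} (hk : 3 ≤ k) (l : List ℕ) {x y : Seq} (hy : InSigma k y)
    {g : ℕ} (h : agree g x y) (hlt : x g < y g) :
    ∃ g', agree g' (lamList k l x) (lamList k l y) ∧ lamList k l x g' < lamList k l y g' ∧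
      l.length ≤ k * g' + lamList k l x g' := by
  induction l with
  | nil => exact ⟨g, h, hlt, by simp⟩
  | cons a t ih =>
    obtain ⟨g', h1, h2, h3⟩ := ih
    obtain ⟨g'', h1', h2', h3'⟩ := lam_step hk a (lamList_insigma hk t hy) h1 h2
    exact ⟨g'', h1', h2', by simp only [lamList, List.length_cons] at *; omega⟩

/-- constant sequence -/
def constSeq (d : ℕ) : Seq := fun _ => d

theorem top_insigma {k : ℕ} (hk : 3 ≤ k) : InSigma k (topSeq k) := fun _ => by
  unfold topSeq; omega
theorem base_insigma {k : ℕ} (hk : 3 ≤ k) : InSigma k (baseSeq k) := fun m => by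
  unfold baseSeq; split_ifs <;> omega

theorem base_lt_top {k : ℕ} (hk : 3 ≤ k) : seqLt (baseSeq k) (topSeq k) :=
  ⟨1, fun s hs => by obtain rfl : s = 0 := by omega
                     simp [baseSeq, topSeq], by simp [baseSeq, topSeq]; omega⟩

theorem le_top {k : ℕ} {w : Seq} (hw : InSigma k w) : seqLe w (topSeq k) := by
  by_contra hc
  rw [not_seqLe] at hc
  obtain ⟨r, _, h⟩ := hc
  have := hw r
  unfold topSeq at h; omega

/-- two concatenations of the same constant block agree -/
theorem lam_top_eq {k : ℕ} (hk : 3 ≤ k) (n : ℕ) :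
    lamSub k (n + 1) (topSeq k) = lamSub k n (constSeq (k - 2)) := by
  rw [lamSub_eq, lamSub_eq]
  congr 1
  funext r
  rw [lamWord_hi (by unfold topSeq; omega), lamWord_mid (by unfold constSeq; omega)]

theorem lam_zero_top {k : ℕ} (hk : 3 ≤ k) : lamSub k 0 (topSeq k) = topSeq k := by
  funext m
  obtain ⟨q, j, hj, rfl⟩ := lam_exists k 0 (topSeq k) m
  rw [lam_at _ _ _ _ _ hj]
  have hw : lamWord k 0 (topSeq k q) = [k - 1] := by
    rw [lamWord_hi (by unfold topSeq; omega)]; rfl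
  have : (lamWord k 0 (topSeq k q))[j] ∈ lamWord k 0 (topSeq k q) := List.getElem_mem _
  generalize (lamWord k 0 (topSeq k q))[j] = d at *
  rw [hw] at this
  simpa [topSeq] using this

/-! ### Endpoints of the mode-locking intervals -/

/-- lower endpoint -/
def loS (k : ℕ) (l : List ℕ) (n : ℕ) : Seq := lamList k l (lamSub k (n + 1) (topSeq k))
/-- upper endpoint -/
def hiS (k : ℕ) (l : List ℕ) (n : ℕ) : Seq := lamList k l (lamSub k n (baseSeq k))

theorem lamChain_eq (k : ℕ) (n : ℕ → ℕ) (r : ℕ) (w : Seq) :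
    lamChain k n r w = lamList k ((List.range (r + 1)).map n) w := by
  induction r generalizing w with
  | zero => rfl
  | succ r ih =>
    rw [List.range_succ, List.map_append, lamList_append, ← ih]
    rfl

theorem Sseq_rat {k : ℕ} (hk : 3 ≤ k) (f : ℕ → ℕ) (R : ℕ) :
    Sseq k (ratSeq f R) = loS k ((List.range R).map f) (f R) := by
  have hR : lamChain k (ratSeq f R) R (topSeq k) = loS k ((List.range R).map f) (f R) := by
    rw [lamChain_eq, List.range_succ, List.map_append, lamList_append]
    have h1 : (List.range R).map (ratSeq f R) = (List.range R).map f := by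
      apply List.map_congr_left
      intro a ha
      rw [List.mem_range] at ha
      simp [ratSeq, ha]
    rw [h1]
    simp [lamList, ratSeq, loS]
  have hge : ∀ r, R ≤ r → lamChain k (ratSeq f R) r (topSeq k) = loS k ((List.range R).map f) (f R) := by
    intro r hr
    induction r, hr using Nat.le_induction with
    | base => exact hR
    | succ r hr ih =>
      rw [← ih]
      show lamChain k (ratSeq f R) r (lamSub k (ratSeq f R (r + 1)) (topSeq k)) = _
      have : ratSeq f R (r + 1) = 0 := by
        unfold ratSeq; rw [if_neg (by omega), if_neg (by omega)]
      rw [this, lam_zero_top hk]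
  unfold Sseq
  apply Tendsto.limUnder_eq
  apply tendsto_const_nhds.congr'
  filter_upwards [eventually_ge_atTop R] with r hr
  exact (hge r hr).symm

theorem SN_fin (k : ℕ) (f : ℕ → ℕ) (R : ℕ) :
    SN k (finNN f R) = hiS k ((List.range R).map f) (f R) := by
  have hv : ∀ r, (finNN f R).1 r = if r ≤ R then (f r : ℕ∞) else ⊤ := fun r => rfl
  have h : ∃ r, (finNN f R).1 r = ⊤ := ⟨R + 1, by rw [hv, if_neg (by omega)]⟩
  have hf : Nat.find h = R + 1 := by
    rw [Nat.find_eq_iff]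
    refine ⟨by rw [hv, if_neg (by omega)], fun m hm => ?_⟩
    rw [hv, if_pos (by omega)]; simp
  unfold SN
  rw [dif_pos h, hf]
  have : (List.range (R + 1)).map (fun r => ((finNN f R).1 r).toNat) = (List.range (R + 1)).map f := by
    apply List.map_congr_left
    intro a ha
    rw [List.mem_range] at ha
    rw [hv, if_pos (by omega)]; simp
  rw [this, List.range_succ, List.map_append, lamList_append]
  rfl

/-- sequences in `Σ` starting with `k-1` and maximal -/
structure Good (k : ℕ) (w : Seq) : Prop where
  sig : InSigma k w
  head : w 0 = k - 1
  max : IsMaximal w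

theorem good_top {k : ℕ} (hk : 3 ≤ k) : Good k (topSeq k) :=
  ⟨top_insigma hk, rfl, fun r => by rw [shift_iter]; exact seqLe_refl _⟩

theorem good_base {k : ℕ} (hk : 3 ≤ k) : Good k (baseSeq k) := by
  refine ⟨base_insigma hk, rfl, fun r => ?_⟩
  rcases r with _ | r
  · exact seqLe_refl _
  · left; apply seqLe_of_head
    rw [shift_iter_apply]; simp [baseSeq]; omega

theorem lam_head_good {k n : ℕ} (hk : 3 ≤ k) {w : Seq} (h : w 0 = k - 1) : lamSub k n w 0 = k - 1 := by
  rw [lam_zero, if_neg (by omega)]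

/-- digit `k-1` only occurs at block starts -/
theorem lam_start {k : ℕ} (hk : 3 ≤ k) {n : ℕ} {w : Seq} {m : ℕ}
    (hm : lamSub k n w m = k - 1) : ∃ q, m = lpos k n w q := by
  obtain ⟨q, j, hj, rfl⟩ := lam_exists k n w m
  rcases j with _ | j
  · exact ⟨q, rfl⟩
  · exfalso
    rw [lam_at _ _ _ _ _ hj] at hm
    have : (lamWord k n (w q))[j + 1] = 0 := by
      unfold lamWord at hj ⊢
      split_ifs at hj ⊢ <;> simp at hj ⊢
    omega

theorem good_lam {k : ℕ} (hk : 3 ≤ k) (n : ℕ) {w : Seq} (h : Good k w) : Good k (lamSub k n w) := by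
  refine ⟨lam_insigma hk _ _, lam_head_good hk h.head, fun r => ?_⟩
  by_cases hr : lamSub k n w r = k - 1
  · obtain ⟨q, rfl⟩ := lam_start hk hr
    rw [lam_shift]
    exact lam_mono hk n h.sig (h.max q)
  · left; apply seqLe_of_head
    rw [shift_iter_apply, Nat.zero_add, lam_head_good hk h.head]
    have := lam_insigma hk n w r
    omega

theorem good_lamList {k : ℕ} (hk : 3 ≤ k) (l : List ℕ) {w : Seq} (h : Good k w) :
    Good k (lamList k l w) := by
  induction l with
  | nil => exact h
  | cons a t ih => exact good_lam hk a ih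

theorem good_lo {k : ℕ} (hk : 3 ≤ k) (l : List ℕ) (n : ℕ) : Good k (loS k l n) :=
  good_lamList hk _ (good_lam hk _ (good_top hk))
theorem good_hi {k : ℕ} (hk : 3 ≤ k) (l : List ℕ) (n : ℕ) : Good k (hiS k l n) :=
  good_lamList hk _ (good_lam hk _ (good_base hk))

/-- not eventually zero -/
def NEZ (w : Seq) : Prop := ∀ r, ∃ m, r ≤ m ∧ w m ≠ 0

theorem nez_lam {k : ℕ} (hk : 3 ≤ k) (n : ℕ) (w : Seq) : NEZ (lamSub k n w) := fun r =>
  ⟨lpos k n w r, le_lpos _ _ _ _, (lam_head_pos hk n w r).ne'⟩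

theorem nez_lamList {k : ℕ} (hk : 3 ≤ k) (l : List ℕ) {w : Seq} (h : NEZ w) :
    NEZ (lamList k l w) := by
  cases l with
  | nil => exact h
  | cons a t => exact nez_lam hk _ _

theorem nez_lo {k : ℕ} (hk : 3 ≤ k) (l : List ℕ) (n : ℕ) : NEZ (loS k l n) :=
  nez_lamList hk _ (nez_lam hk _ _)
theorem nez_hi {k : ℕ} (hk : 3 ≤ k) (l : List ℕ) (n : ℕ) : NEZ (hiS k l n) :=
  nez_lamList hk _ (nez_lam hk _ _)

theorem base_lt {k : ℕ} {w : Seq} (h0 : w 0 = k - 1) (hn : NEZ w) : seqLt (baseSeq k) w := by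
  obtain ⟨m, hm, hne⟩ := hn 1
  by_contra hc
  rw [not_seqLt] at hc
  rcases hc with ⟨r, h1, h2⟩ | rfl
  · unfold baseSeq at h2
    split_ifs at h2
    · subst_vars; omega
    · omega
  · unfold baseSeq at hne
    rw [if_neg (by omega)] at hne
    exact hne rfl

/-- `Λ_{a+1}(top) < Λ_a(base)` -/
theorem lam_gap {k : ℕ} (hk : 3 ≤ k) (a : ℕ) :
    seqLt (lamSub k (a + 1) (topSeq k)) (lamSub k a (baseSeq k)) := by
  rw [lam_top_eq hk]
  apply lam_strictMono hk a (base_insigma hk)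
  apply seqLe_of_head
  simp [constSeq, baseSeq]; omega

theorem lam_top_anti_succ {k : ℕ} (hk : 3 ≤ k) (a : ℕ) :
    seqLt (lamSub k (a + 1) (topSeq k)) (lamSub k a (topSeq k)) :=
  seqLt_trans (lam_gap hk a) (lam_strictMono hk a (top_insigma hk) (base_lt_top hk))

theorem lam_top_anti {k : ℕ} (hk : 3 ≤ k) {a b : ℕ} (h : a ≤ b) :
    seqLe (lamSub k b (topSeq k)) (lamSub k a (topSeq k)) := by
  induction b, h using Nat.le_induction with
  | base => exact seqLe_refl _
  | succ b hb ih => exact seqLe_trans (Or.inl (lam_top_anti_succ hk b)) ih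

theorem lo_lt_hi {k : ℕ} (hk : 3 ≤ k) (l : List ℕ) (n : ℕ) : seqLt (loS k l n) (hiS k l n) :=
  lamList_strictMono hk l (lam_insigma hk _ _) (lam_gap hk n)

theorem lamList_top_le {k : ℕ} (hk : 3 ≤ k) (l : List ℕ) : seqLe (lamList k l (topSeq k)) (topSeq k) :=
  le_top (lamList_insigma hk l (top_insigma hk))

theorem hi_lt_top {k : ℕ} (hk : 3 ≤ k) (l : List ℕ) (n : ℕ) : seqLt (hiS k l n) (topSeq k) := by
  refine seqLt_of_lt_of_le ?_ (lamList_top_le hk l)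
  apply lamList_strictMono hk l (top_insigma hk)
  exact seqLt_of_lt_of_le (lam_strictMono hk n (top_insigma hk) (base_lt_top hk))
    (le_top (lam_insigma hk _ _))

theorem base_lt_lo {k : ℕ} (hk : 3 ≤ k) (l : List ℕ) (n : ℕ) : seqLt (baseSeq k) (loS k l n) :=
  base_lt (good_lo hk l n).head (nez_lo hk l n)

theorem hi_lt_lo_of_lt {k : ℕ} (hk : 3 ≤ k) {a b : ℕ} (hab : a < b) {x y : Seq} 
    (hx : seqLt (baseSeq k) x) (hxs : InSigma k x) (hy : seqLt y (topSeq k)) :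
    seqLt (lamSub k b y) (lamSub k a x) := by
  refine seqLt_trans (lam_strictMono hk b (top_insigma hk) hy) ?_
  refine seqLt_of_le_of_lt (lam_top_anti hk (show a + 1 ≤ b from hab)) ?_
  exact seqLt_trans (lam_gap hk a) (lam_strictMono hk a hxs hx)

theorem gaps_disjoint {k : ℕ} (hk : 3 ≤ k) : ∀ (l l' : List ℕ) (n n' : ℕ), (l ≠ l' ∨ n ≠ n') →
    seqLt (hiS k l n) (loS k l' n') ∨ seqLt (hiS k l' n') (loS k l n) := by
  have key : ∀ a l' n n', seqLt (hiS k [] n) (loS k (a :: l') n') ∨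
      seqLt (hiS k (a :: l') n') (loS k [] n) := by
    intro a l' n n'
    rcases lt_trichotomy a n with h | rfl | h
    · left
      exact hi_lt_lo_of_lt hk h (base_lt_lo hk l' n') (good_lo hk l' n').sig (base_lt_top hk)
    · left
      exact lam_strictMono hk _ (good_lo hk l' n').sig (base_lt_lo hk l' n')
    · right
      exact seqLt_of_lt_of_le (lam_strictMono hk a (top_insigma hk) (hi_lt_top hk l' n'))
        (lam_top_anti hk (show n + 1 ≤ a from h))
  have key0 : ∀ n n', n < n' → seqLt (hiS k [] n') (loS k [] n) := by
    intro n n' h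
    exact seqLt_of_lt_of_le (lam_strictMono hk n' (top_insigma hk) (base_lt_top hk))
        (lam_top_anti hk (show n + 1 ≤ n' from h))
  intro l
  induction l with
  | nil =>
    intro l' n n' h
    cases l' with
    | nil =>
      have hn : n ≠ n' := by simpa using h
      rcases lt_or_gt_of_ne hn with h | h
      · exact Or.inr (key0 _ _ h)
      · exact Or.inl (key0 _ _ h)
    | cons a t => exact key a t n n'
  | cons a t ih =>
    intro l' n n' h
    cases l' with
    | nil => exact (key a t n' n).symm
    | cons a' t' =>
      rcases lt_trichotomy a a' with hl | rfl | hl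
      · right
        exact hi_lt_lo_of_lt hk hl (base_lt_lo hk t n) (good_lo hk t n).sig (hi_lt_top hk t' n')
      · have h' : t ≠ t' ∨ n ≠ n' := by
          rcases h with h | h
          · left; rintro rfl; exact h rfl
          · exact Or.inr h
        rcases ih t' n n' h' with h | h
        · left; exact lam_strictMono hk a (good_lo hk t' n').sig h
        · right; exact lam_strictMono hk a (good_lo hk t n).sig h
      · left
        exact hi_lt_lo_of_lt hk hl (base_lt_lo hk t' n') (good_lo hk t' n').sig (hi_lt_top hk t n)

/-! ### Outside the gaps -/

theorem lam_top_agree_base {k : ℕ} (m : ℕ) :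
    agree (m + 1) (lamSub k m (topSeq k)) (baseSeq k) := by
  intro j hj
  by_cases hk : 2 ≤ k
  · have hw : lamWord k m (topSeq k 0) = (k - 1) :: List.replicate m 0 :=
      lamWord_hi (by unfold topSeq; omega)
    have := lam_at k m (topSeq k) 0 j (by rw [hw]; simpa using hj)
    rw [show lpos k m (topSeq k) 0 = 0 from rfl, Nat.zero_add] at this
    rw [this]
    simp only [hw]
    rcases j with _ | j
    · simp [baseSeq]
    · simp [baseSeq]
  · have hw : lamWord k m (topSeq k 0) = (k - 1) :: List.replicate m 0 :=
      lamWord_hi (by unfold topSeq; omega)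
    have := lam_at k m (topSeq k) 0 j (by rw [hw]; simpa using hj)
    rw [show lpos k m (topSeq k) 0 = 0 from rfl, Nat.zero_add] at this
    rw [this]
    simp only [hw]
    rcases j with _ | j
    · simp [baseSeq]
    · simp [baseSeq]

/-- `w` lies strictly inside the cylinder of `l` -/
def Btw (k : ℕ) (l : List ℕ) (w : Seq) : Prop :=
  seqLt (lamList k l (baseSeq k)) w ∧ seqLt w (lamList k l (topSeq k))

theorem btw_step {k : ℕ} (hk : 3 ≤ k) {w : Seq} 
    (hgap : ∀ l n, ¬ (seqLe (loS k l n) w ∧ seqLe w (hiS k l n))) (l : List ℕ) (h : Btw k l w) :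
    ∃ m, Btw k (l ++ [m]) w := by
  have hex : ∃ m, seqLe (lamList k l (lamSub k m (topSeq k))) w := by
    obtain ⟨⟨d, h1, h2⟩, _⟩ := h
    have ha := lamList_agree (k := k) l (lam_top_agree_base (k := k) d)
    exact ⟨d, Or.inl ⟨d, fun s hs => (ha s (by omega)).trans (h1 s hs), by
      rw [ha d (by omega)]; exact h2⟩⟩
  have hspec := Nat.find_spec hex
  have hmin := fun m => Nat.find_min hex (m := m)
  generalize Nat.find hex = m0 at *
  rcases m0 with _ | m
  · rw [lam_zero_top hk] at hspec
    exact absurd (seqLt_of_le_of_lt hspec h.2) seqLt_irrefl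
  · refine ⟨m, ?_, ?_⟩
    · rw [lamList_append]
      have := hgap l m
      rw [not_and, not_seqLe] at this
      exact this hspec
    · rw [lamList_append]
      exact not_seqLe.1 (hmin m (by omega))

theorem btw_seq {k : ℕ} (hk : 3 ≤ k) {w : Seq} 
    (hgap : ∀ l n, ¬ (seqLe (loS k l n) w ∧ seqLe w (hiS k l n)))
    (h1 : seqLt (baseSeq k) w) (h2 : seqLt w (topSeq k)) :
    ∃ s m : ℕ, 1 ≤ m ∧ ∀ M, ∃ v, InSigma k v ∧
      agree M w (lamList k (List.replicate s 0) (lamSub k m v)) := by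
  choose! nx hnx using btw_step hk hgap
  let L : ℕ → List ℕ := fun r => Nat.rec [] (fun _ l => l ++ [nx l]) r
  have hL0 : L 0 = [] := rfl
  have hLs : ∀ r, L (r + 1) = L r ++ [nx (L r)] := fun r => rfl
  have hB : ∀ r, Btw k (L r) w := by
    intro r
    induction r with
    | zero => exact ⟨h1, h2⟩
    | succ r ih => rw [hLs]; exact hnx _ ih
  have hlen : ∀ r, (L r).length = r := by
    intro r
    induction r with
    | zero => rfl
    | succ r ih => rw [hLs]; simp [ih]
  have hpre : ∀ r j, ∃ l', L (r + j) = L r ++ l' := by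
    intro r j
    induction j with
    | zero => exact ⟨[], by simp⟩
    | succ j ih =>
      obtain ⟨l', h'⟩ := ih
      exact ⟨l' ++ [nx (L (r + j))], by rw [← Nat.add_assoc, hLs, h']; simp⟩
  -- agreement with the top sequences
  have hag : ∀ M, ∀ r, k * M + k ≤ r → agree M w (lamList k (L r) (topSeq k)) := by
    intro M r hr
    have hbt := base_lt_top hk
    obtain ⟨g, hg1, hg2⟩ := hbt
    obtain ⟨g', ha, hlt, hle⟩ := lamList_step hk (L r) (top_insigma hk) hg1 hg2
    have hs := lamList_insigma hk (L r) (base_insigma hk) g'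
    have : M ≤ g' := by
      by_contra hc
      push Not at hc
      have : k * (g' + 1) ≤ k * M := Nat.mul_le_mul_left _ hc
      rw [hlen] at hle
      rw [mul_add] at this
      omega
    exact (agree_squeeze ha (Or.inl (hB r).1) (Or.inl (hB r).2)).mono this
  have hnz : ∃ r, ∃ a ∈ L r, a ≠ 0 := by
    by_contra hc
    push Not at hc
    have hrep : ∀ r, lamList k (L r) (topSeq k) = topSeq k := by
      intro r
      have : ∀ l : List ℕ, (∀ a ∈ l, a = 0) → lamList k l (topSeq k) = topSeq k := by
        intro l
        induction l with
        | nil => intro _; rfl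
        | cons a t ih =>
          intro h
          simp only [lamList]
          rw [ih (fun b hb => h b (by simp [hb])), h a (by simp), lam_zero_top hk]
      exact this _ (hc r)
    have : w = topSeq k := by
      funext j
      have := hag (j + 1) _ le_rfl j (by omega)
      rw [hrep] at this
      exact this
    subst this
    exact seqLt_irrefl h2
  obtain ⟨r0, a, ha, ha0⟩ := hnz
  have hdec : ∀ l : List ℕ, (∃ a ∈ l, a ≠ 0) → ∃ s m l', 1 ≤ m ∧ l = List.replicate s 0 ++ m :: l' := by
    intro l
    induction l with
    | nil => rintro ⟨a, ha, _⟩; simp at ha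
    | cons b t ih =>
      rintro ⟨a, ha, ha0⟩
      by_cases hb : b = 0
      · subst hb
        obtain ⟨s, m, l', hm, rfl⟩ := ih ⟨a, (List.mem_cons.1 ha).resolve_left (by rintro rfl; exact ha0 rfl), ha0⟩
        exact ⟨s + 1, m, l', hm, by simp [List.replicate_succ]⟩
      · exact ⟨0, b, t, by omega, by simp⟩
  obtain ⟨s, m, l', hm, hl⟩ := hdec (L r0) ⟨a, ha, ha0⟩
  refine ⟨s, m, hm, fun M => ?_⟩
  obtain ⟨l'', hl''⟩ := hpre r0 (k * M + k)
  refine ⟨lamList k (l' ++ l'') (topSeq k), lamList_insigma hk _ (top_insigma hk), ?_⟩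
  have := hag M (r0 + (k * M + k)) (by omega)
  rw [hl'', hl] at this
  simpa [lamList_append, lamList] using this

/-! ### Beta expansions -/

/-- `w` is the quasi-greedy expansion of `1` in base `β`, with orbit `t`. -/
structure QG (β : ℝ) (w : Seq) (t : ℕ → ℝ) : Prop where
  zero : t 0 = 1
  pos : ∀ r, 0 < t r
  le : ∀ r, t r ≤ 1
  step : ∀ r, t (r + 1) = β * t r - w r

theorem qg_unique {β : ℝ} {w w' : Seq} {t t' : ℕ → ℝ} (h : QG β w t) (h' : QG β w' t') : w = w' := by
  have key : ∀ r, t r = t' r → w r = w' r := by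
    intro r hr
    have h1 := h.step r
    have h2 := h'.step r
    rw [← hr] at h2
    have := h.pos (r + 1); have := h.le (r + 1); have := h'.pos (r + 1); have := h'.le (r + 1)
    have a1 : (w r : ℝ) < w' r + 1 := by linarith
    have a2 : (w' r : ℝ) < w r + 1 := by linarith
    have b1 : w r < w' r + 1 := by exact_mod_cast a1
    have b2 : w' r < w r + 1 := by exact_mod_cast a2
    omega
  have ht : ∀ r, t r = t' r := by
    intro r
    induction r with
    | zero => rw [h.zero, h'.zero]
    | succ r ih => rw [h.step, h'.step, key r ih, ih]
  funext r
  exact key r (ht r)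

theorem fb_nonneg {β : ℝ} {x : ℝ} (hx : 0 ≤ x) (r : ℕ) : 0 ≤ (fbeta β)^[r] x := by
  cases r with
  | zero => exact hx
  | succ r => rw [Function.iterate_succ_apply']; exact Int.fract_nonneg _

theorem fb_lt {β : ℝ} {x : ℝ} (hx : x < 1) (r : ℕ) : (fbeta β)^[r] x < 1 := by
  cases r with
  | zero => exact hx
  | succ r => rw [Function.iterate_succ_apply']; exact Int.fract_lt_one _

theorem fb_le {β : ℝ} {x : ℝ} (hx : x ≤ 1) (r : ℕ) : (fbeta β)^[r] x ≤ 1 := by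
  cases r with
  | zero => exact hx
  | succ r => rw [Function.iterate_succ_apply']; exact (Int.fract_lt_one _).le

theorem fb_step {β : ℝ} (hβ : 0 ≤ β) {x : ℝ} (hx : 0 ≤ x) (r : ℕ) :
    (fbeta β)^[r + 1] x = β * (fbeta β)^[r] x - dbeta β x r := by
  rw [Function.iterate_succ_apply', dbeta, fbeta, ← Int.self_sub_floor,
    natCast_floor_eq_intCast_floor (mul_nonneg hβ (fb_nonneg hx r))]

theorem qg_wbeta {β : ℝ} (hβ : 1 < β) : ∃ t, QG β (wbeta β) t := by
  set T : ℕ → ℝ := fun r => (fbeta β)^[r] 1 with hT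
  have T0 : T 0 = 1 := rfl
  have Tnn : ∀ r, 0 ≤ T r := fb_nonneg zero_le_one
  have Tle : ∀ r, T r ≤ 1 := fb_le le_rfl
  have Tst : ∀ r, T (r + 1) = β * T r - dbeta β 1 r := fb_step (by linarith) zero_le_one
  have Tz : ∀ r, T r = 0 → ∀ s, r ≤ s → T s = 0 ∧ dbeta β 1 s = 0 := by
    intro r hr s hs
    have hd : ∀ s, T s = 0 → dbeta β 1 s = 0 := by
      intro s h
      show ⌊β * T s⌋₊ = 0
      rw [h]; simp
    induction s, hs using Nat.le_induction with
    | base => exact ⟨hr, hd r hr⟩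
    | succ s hs ih =>
      have : T (s + 1) = 0 := by rw [Tst, ih.1, ih.2]; simp
      exact ⟨this, hd _ this⟩
  have d0 : dbeta β 1 0 ≠ 0 := by
    show ⌊β * T 0⌋₊ ≠ 0
    rw [T0, mul_one]
    exact (Nat.floor_pos.2 hβ.le).ne'
  by_cases h : ∃ r, dbeta β 1 r ≠ 0 ∧ ∀ s, r < s → dbeta β 1 s = 0
  · set ρ := Nat.find h with hρ
    obtain ⟨h1, h2⟩ := Nat.find_spec h
    rw [← hρ] at h1 h2
    have hz : T (ρ + 1) = 0 := by
      have hp : ∀ n, T (ρ + 1 + n) = β ^ n * T (ρ + 1) := by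
        intro n
        induction n with
        | zero => simp
        | succ n ih =>
          rw [← add_assoc, Tst, ih, h2 _ (by omega), pow_succ]; simp; ring
      by_contra hne
      have hpos : 0 < T (ρ + 1) := lt_of_le_of_ne (Tnn _) (Ne.symm hne)
      obtain ⟨n, hn⟩ := pow_unbounded_of_one_lt (1 / T (ρ + 1)) hβ
      have := Tle (ρ + 1 + n)
      rw [hp] at this
      rw [div_lt_iff₀ hpos] at hn
      linarith
    have hpos : ∀ r, r ≤ ρ → 0 < T r := by
      intro r hr
      refine lt_of_le_of_ne (Tnn _) (fun he => ?_)
      exact h1 (Tz r he.symm ρ hr).2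
    refine ⟨fun m => T (m % (ρ + 1)), ?_, ?_, ?_, ?_⟩
    · simp [T0]
    · intro r; exact hpos _ (Nat.lt_succ_iff.1 (Nat.mod_lt _ (by omega)))
    · intro r; exact Tle _
    · intro r
      have hw : wbeta β r = if r % (ρ + 1) = ρ then dbeta β 1 ρ - 1 else dbeta β 1 (r % (ρ + 1)) := by
        unfold wbeta; rw [dif_pos h]
      have hlt := Nat.mod_lt r (show 0 < ρ + 1 by omega)
      have hmod : (r + 1) % (ρ + 1) = (r % (ρ + 1) + 1) % (ρ + 1) := by simp
      show T ((r + 1) % (ρ + 1)) = _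
      by_cases hr : r % (ρ + 1) = ρ
      · rw [hw, if_pos hr, hmod, hr, Nat.mod_self, T0]
        have := Tst ρ
        rw [hz] at this
        rw [Nat.cast_sub (by omega)]; push_cast; linarith
      · rw [hw, if_neg hr, hmod, Nat.mod_eq_of_lt (by omega), Tst]
  · have hw : wbeta β = dbeta β 1 := by unfold wbeta; rw [dif_neg h]
    refine ⟨T, T0, fun r => ?_, Tle, fun r => by rw [hw, Tst]⟩
    refine lt_of_le_of_ne (Tnn _) (fun he => h ?_)
    have hz := Tz r he.symm
    have hex : ∃ s, ∀ u, s ≤ u → dbeta β 1 u = 0 := ⟨r, fun u hu => (hz u hu).2⟩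
    have hs := Nat.find_spec hex
    have hm := fun m => Nat.find_min hex (m := m)
    rcases hf : Nat.find hex with _ | s
    · rw [hf] at hs; exact absurd (hs 0 le_rfl) d0
    · rw [hf] at hs hm
      refine ⟨s, fun hc => ?_, fun u hu => hs u hu⟩
      refine hm s (by omega) fun u hu => ?_
      rcases Nat.lt_or_ge s u with h3 | h3
      · exact hs u h3
      · rw [show u = s by omega]; exact hc

theorem wbeta_eq {β : ℝ} (hβ : 1 < β) {w : Seq} {t : ℕ → ℝ} (h : QG β w t) : wbeta β = w := by
  obtain ⟨t', h'⟩ := qg_wbeta hβ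
  exact qg_unique h' h

theorem qg_diff {β β' : ℝ} (hβ : 1 < β) (hlt : β < β') {w w' : Seq} {t t' : ℕ → ℝ} (h : QG β w t)
    (h' : QG β' w' t') {N : ℕ} (ha : agree (N + 1) w w') :
    β ^ N * (β' - β) ≤ t' (N + 1) - t (N + 1) := by
  induction N with
  | zero =>
    rw [h.step, h'.step, h.zero, h'.zero, ha 0 (by omega)]; simp
  | succ N ih =>
    have := ih (ha.mono (by omega))
    rw [h.step (N + 1), h'.step (N + 1), ha (N + 1) (by omega), pow_succ]
    have := h'.pos (N + 1)
    nlinarith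

theorem qg_diam {β β' : ℝ} (hβ : 1 < β) (hlt : β < β') {w w' : Seq} {t t' : ℕ → ℝ} (h : QG β w t)
    (h' : QG β' w' t') {N : ℕ} (ha : agree (N + 1) w w') :
    β ^ N * (β' - β) < 1 := by
  have := qg_diff hβ hlt h h' ha
  have := h.pos (N + 1)
  have := h'.le (N + 1)
  linarith

theorem qg_mono {β β' : ℝ} (hβ : 1 < β) (hlt : β < β') {w w' : Seq} {t t' : ℕ → ℝ} (h : QG β w t)
    (h' : QG β' w' t') : seqLt w w' := by
  have hne : ∃ r, w r ≠ w' r := by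
    by_contra hc
    push Not at hc
    obtain ⟨n, hn⟩ := pow_unbounded_of_one_lt (1 / (β' - β)) hβ
    rw [div_lt_iff₀ (by linarith)] at hn
    have := qg_diam hβ hlt h h' (N := n) (fun m _ => hc m)
    linarith
  have hs := Nat.find_spec hne
  have hm := fun m => Nat.find_min hne (m := m)
  set r := Nat.find hne
  refine ⟨r, fun s hs => by simpa using hm s hs, ?_⟩
  have hd : t r ≤ t' r := by
    rcases hr : r with _ | q
    · rw [h.zero, h'.zero]
    · have := qg_diff hβ hlt h h' (N := q) (fun s hs => by simpa using hm s (by omega))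
      have : 0 ≤ β ^ q * (β' - β) := mul_nonneg (by positivity) (by linarith)
      linarith
  have h1 := h.step r
  have h2 := h'.step r
  have := h.pos r; have := h.pos (r+1); have := h'.le (r+1)
  have : β * t r < β' * t' r := by nlinarith
  have a : (w r : ℝ) < w' r + 1 := by linarith
  have b : w r < w' r + 1 := by exact_mod_cast a
  omega

theorem qg_top {k : ℕ} (hk : 3 ≤ k) : QG (k : ℝ) (topSeq k) (fun _ => 1) :=
  ⟨rfl, fun _ => one_pos, fun _ => le_rfl, fun r => by
    unfold topSeq; rw [Nat.cast_sub (by omega)]; simp⟩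

theorem base_gt_one {k : ℕ} (hk : 3 ≤ k) {β : ℝ} (h : (k : ℝ) - 1 < β) : 1 < β := by
  have : (3 : ℝ) ≤ k := by exact_mod_cast hk
  linarith

theorem wbeta_lt_top {k : ℕ} (hk : 3 ≤ k) {β : ℝ} (h1 : (k : ℝ) - 1 < β) (h2 : β < k) :
    seqLt (wbeta β) (topSeq k) := by
  obtain ⟨t, ht⟩ := qg_wbeta (base_gt_one hk h1)
  exact qg_mono (base_gt_one hk h1) h2 ht (qg_top hk)

theorem wbeta_mono {β β' : ℝ} (hβ : 1 < β) (h : β < β') : seqLt (wbeta β) (wbeta β') := by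
  obtain ⟨t, ht⟩ := qg_wbeta hβ
  obtain ⟨t', ht'⟩ := qg_wbeta (hβ.trans h)
  exact qg_mono hβ h ht ht'

theorem wbeta_le_iff {β β' : ℝ} (hβ : 1 < β) (hβ' : 1 < β') : seqLe (wbeta β) (wbeta β') ↔ β ≤ β' := by
  constructor
  · intro h
    by_contra hc
    push Not at hc
    exact seqLt_irrefl (seqLt_of_le_of_lt h (wbeta_mono hβ' hc))
  · intro h
    rcases h.lt_or_eq with h | rfl
    · exact Or.inl (wbeta_mono hβ h)
    · exact seqLe_refl _

theorem qg_insigma {k : ℕ} {β : ℝ} (h2 : β < k) (hβ : 1 < β) {w : Seq} {t : ℕ → ℝ} (h : QG β w t) :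
    InSigma k w := by
  intro r
  have a1 := h.step r
  have := h.pos (r+1)
  have := h.le r
  have : (w r : ℝ) < k := by nlinarith
  exact_mod_cast this

theorem qg_head {k : ℕ} (hk : 3 ≤ k) {β : ℝ} (h1 : (k : ℝ) - 1 < β) (h2 : β < k) {w : Seq} {t : ℕ → ℝ} (h : QG β w t) :
    w 0 = k - 1 := by
  have a1 := h.step 0
  rw [h.zero] at a1
  have := h.pos 1
  have := h.le 1
  have b1 : (w 0 : ℝ) < k := by simp at a1; linarith
  have b2 : (k : ℝ) < w 0 + 2 := by simp at a1; linarith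
  have c1 : w 0 < k := by exact_mod_cast b1
  have c2 : k < w 0 + 2 := by exact_mod_cast b2
  omega

theorem qg_nez {β : ℝ} (hβ : 1 < β) {w : Seq} {t : ℕ → ℝ} (h : QG β w t) : NEZ w := by
  intro r
  by_contra hc
  push Not at hc
  have hp : ∀ n, t (r + n) = β ^ n * t r := by
    intro n
    induction n with
    | zero => simp
    | succ n ih => rw [← add_assoc, h.step, ih, hc _ (by omega), pow_succ]; simp; ring
  obtain ⟨n, hn⟩ := pow_unbounded_of_one_lt (1 / t r) hβ
  rw [div_lt_iff₀ (h.pos r)] at hn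
  have := h.le (r + n)
  rw [hp] at this
  linarith

theorem base_lt_wbeta {k : ℕ} (hk : 3 ≤ k) {β : ℝ} (h1 : (k : ℝ) - 1 < β) (h2 : β < k) :
    seqLt (baseSeq k) (wbeta β) := by
  obtain ⟨t, ht⟩ := qg_wbeta (base_gt_one hk h1)
  exact base_lt (qg_head hk h1 h2 ht) (qg_nez (base_gt_one hk h1) ht)

/-! ### Values -/

/-- the value of a sequence in base `β` -/
noncomputable def val (β : ℝ) (v : Seq) : ℝ := ∑' i, (v i : ℝ) * (β⁻¹) ^ (i + 1)

theorem val_summable {k : ℕ} {β : ℝ} (hβ : 1 < β) {v : Seq} (hv : InSigma k v) :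
    Summable fun i => (v i : ℝ) * (β⁻¹) ^ (i + 1) := by
  have hg : Summable fun i : ℕ => (k : ℝ) * ((β⁻¹) ^ (i + 1)) := by
    apply Summable.mul_left
    exact (summable_nat_add_iff 1).2 (summable_geometric_of_lt_one (by positivity) (inv_lt_one_of_one_lt₀ hβ))
  refine Summable.of_nonneg_of_le (fun i => by positivity) (fun i => ?_) hg
  have : (v i : ℝ) ≤ k := by exact_mod_cast (hv i).le
  have : 0 ≤ (β⁻¹) ^ (i + 1) := by positivity
  gcongr

theorem val_nonneg {β : ℝ} (hβ : 1 < β) (v : Seq) : 0 ≤ val β v :=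
  tsum_nonneg fun i => by positivity

theorem val_step {k : ℕ} {β : ℝ} (hβ : 1 < β) {v : Seq} (hv : InSigma k v) :
    β * val β v = v 0 + val β (shift v) := by
  have hb : β ≠ 0 := by positivity
  unfold val
  rw [(val_summable hβ hv).tsum_eq_zero_add, mul_add]
  congr 1
  · simp; field_simp
  · rw [← tsum_mul_left]
    congr 1; funext i
    simp only [shift]
    rw [pow_succ _ (i + 1)]
    field_simp

theorem val_le {k : ℕ} {β : ℝ} (hβ : 1 < β) {v : Seq} (hv : InSigma k v) :
    val β v ≤ ∑' i : ℕ, (k : ℝ) * ((β⁻¹) ^ (i + 1)) := by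
  have hg : Summable fun i : ℕ => (k : ℝ) * ((β⁻¹) ^ (i + 1)) := by
    apply Summable.mul_left
    exact (summable_nat_add_iff 1).2 (summable_geometric_of_lt_one (by positivity) (inv_lt_one_of_one_lt₀ hβ))
  refine Summable.tsum_le_tsum (fun i => ?_) (val_summable hβ hv) hg
  have : (v i : ℝ) ≤ k := by exact_mod_cast (hv i).le
  have : 0 ≤ (β⁻¹) ^ (i + 1) := by positivity
  gcongr

theorem val_step' {k : ℕ} {β : ℝ} (hβ : 1 < β) {v : Seq} (hv : InSigma k v) (r : ℕ) :
    β * val β (shift^[r] v) = v r + val β (shift^[r + 1] v) := by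
  rw [val_step hβ (insigma_shift hv r), shift_iter_apply, Function.iterate_succ_apply']; simp

theorem val_agree {k : ℕ} {β : ℝ} (hβ : 1 < β) {v w : Seq} (hv : InSigma k v) (hw : InSigma k w)
    {g : ℕ} (h : agree g v w) :
    val β (shift^[g] v) - val β (shift^[g] w) = β ^ g * (val β v - val β w) := by
  induction g with
  | zero => simp
  | succ g ih =>
    have h1 := val_step' hβ hv g
    have h2 := val_step' hβ hw g
    rw [h g (by omega)] at h1
    have := ih (h.mono (by omega))
    rw [pow_succ]
    linear_combination β * this - h1 + h2

theorem parry {k : ℕ} {β : ℝ} (hβ : 1 < β) {w : Seq} (hw : InSigma k w) (hval : val β w = 1)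
    {v : Seq} (hv : InSigma k v) (h : ∀ r, seqLe (shift^[r] v) w) : val β v ≤ 1 := by
  set C := ∑' i : ℕ, (k : ℝ) * ((β⁻¹) ^ (i + 1)) with hC
  have hC0 : 0 ≤ C := tsum_nonneg fun i => by positivity
  have key : ∀ n : ℕ, ∀ v, InSigma k v → (∀ r, seqLe (shift^[r] v) w) → β ^ n * (val β v - 1) ≤ C := by
    intro n
    induction n with
    | zero =>
      intro v hv _
      have := val_le hβ hv
      simp; linarith
    | succ n ih =>
      intro v hv h
      rcases h 0 with ⟨g, h1, h2⟩ | he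
      · simp only [Function.iterate_zero, id] at h1 h2
        have ha := val_agree hβ hv hw h1
        have s1 := val_step' hβ hv g
        have s2 := val_step' hβ hw g
        have hI := ih (shift^[g+1] v) (insigma_shift hv _) (fun r => by
          rw [← Function.iterate_add_apply]; exact h _)
        have hp := val_nonneg hβ (shift^[g+1] w)
        have h_int1 : (v g : ℝ) + 1 ≤ w g := by exact_mod_cast h2
        rw [hval] at ha
        have e : β ^ (g + 1) * (val β v - 1) ≤ val β (shift^[g+1] v) - 1 := by
          have : β ^ (g + 1) * (val β v - 1) = β * (β ^ g * (val β v - 1)) := by ring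
          rw [this, ← ha]; linarith
        by_cases hneg : val β v - 1 ≤ 0
        · have : β ^ (n + 1) * (val β v - 1) ≤ 0 := mul_nonpos_of_nonneg_of_nonpos (by positivity) hneg
          linarith
        · push Not at hneg
          have hb : (1:ℝ) ≤ β ^ g := one_le_pow₀ hβ.le
          calc β ^ (n + 1) * (val β v - 1) ≤ β ^ (n + 1) * (val β v - 1) * β ^ g :=
                le_mul_of_one_le_right (by positivity) hb
            _ = β ^ n * (β ^ (g + 1) * (val β v - 1)) := by ring
            _ ≤ β ^ n * (val β (shift^[g+1] v) - 1) := by gcongr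
            _ ≤ C := hI
      · simp only [Function.iterate_zero, id] at he
        rw [he, hval]; simpa using hC0
  by_contra hc
  push Not at hc
  obtain ⟨n, hn⟩ := pow_unbounded_of_one_lt (C / (val β v - 1)) hβ
  rw [div_lt_iff₀ (by linarith)] at hn
  exact absurd (key n v hv h) (by linarith)

theorem qg_val {k : ℕ} {β : ℝ} (hβ : 1 < β) {w : Seq} (hw : InSigma k w) {t : ℕ → ℝ} (h : QG β w t) :
    val β w = 1 := by
  have hd : ∀ n, t n - val β (shift^[n] w) = β ^ n * (1 - val β w) := by
    intro n
    induction n with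
    | zero => simp [h.zero]
    | succ n ih =>
      have := val_step' hβ hw n
      rw [h.step, pow_succ]
      linear_combination β * ih + this
  set C := ∑' i : ℕ, (k : ℝ) * ((β⁻¹) ^ (i + 1)) with hC
  have hb : ∀ n, |β ^ n * (1 - val β w)| ≤ 1 + C := by
    intro n
    rw [← hd, abs_le]
    have := h.pos n; have := h.le n
    have := val_nonneg hβ (shift^[n] w)
    have := val_le hβ (insigma_shift hw n)
    constructor <;> linarith
  by_contra hc
  have hpos : 0 < |1 - val β w| := abs_pos.2 (sub_ne_zero.2 (Ne.symm hc))
  obtain ⟨n, hn⟩ := pow_unbounded_of_one_lt ((1 + C) / |1 - val β w|) hβ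
  rw [div_lt_iff₀ hpos] at hn
  have := hb n
  rw [abs_mul, abs_of_pos (show (0:ℝ) < β ^ n by positivity)] at this
  linarith

theorem qg_shift_val {k : ℕ} {β : ℝ} (hβ : 1 < β) {w : Seq} (hw : InSigma k w) {t : ℕ → ℝ} (h : QG β w t)
    (n : ℕ) : val β (shift^[n] w) = t n := by
  induction n with
  | zero => simp [h.zero, qg_val hβ hw h]
  | succ n ih =>
    have := val_step' hβ hw n
    rw [ih] at this
    rw [h.step]; linarith

theorem val_pos {k : ℕ} {β : ℝ} (hβ : 1 < β) {v : Seq} (hv : InSigma k v) (hn : NEZ v) : 0 < val β v := by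
  obtain ⟨m, _, hm⟩ := hn 0
  unfold val
  refine (val_summable hβ hv).tsum_pos (fun i => by positivity) m ?_
  have : 0 < v m := Nat.pos_of_ne_zero hm
  positivity

theorem nez_shift {w : Seq} (h : NEZ w) (r : ℕ) : NEZ (shift^[r] w) := by
  intro s
  obtain ⟨m, h1, h2⟩ := h (s + r)
  exact ⟨m - r, by omega, by rw [shift_iter_apply, Nat.sub_add_cancel (by omega)]; exact h2⟩

theorem exists_beta {k : ℕ} (hk : 3 ≤ k) {w : Seq} (hw : Good k w) (hn : NEZ w) (hlt : seqLt w (topSeq k)) :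
    ∃ β : ℝ, (k : ℝ) - 1 < β ∧ β < k ∧ wbeta β = w := by
  have hk3 : (3 : ℝ) ≤ k := by exact_mod_cast hk
  have hcont : ContinuousOn (fun β => val β w) (Set.Icc ((k : ℝ) - 1) k) := by
    unfold val
    refine continuousOn_tsum (u := fun i : ℕ => (k : ℝ) * (((k : ℝ) - 1)⁻¹) ^ (i + 1)) ?_ ?_ ?_
    · intro i
      refine ContinuousOn.mul continuousOn_const (ContinuousOn.pow ?_ _)
      refine continuousOn_inv₀.mono fun x hx => ?_
      have := hx.1
      simp only [Set.mem_compl_iff, Set.mem_singleton_iff]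
      intro h0; linarith
    · apply Summable.mul_left
      exact (summable_nat_add_iff 1).2 (summable_geometric_of_lt_one
        (inv_nonneg.2 (by linarith)) (inv_lt_one_of_one_lt₀ (by linarith)))
    · intro i x hx
      have hx1 := hx.1
      have hx0 : 0 < x := by linarith
      have hk0 : (0:ℝ) < (k:ℝ) - 1 := by linarith
      rw [Real.norm_of_nonneg (by positivity)]
      have : (w i : ℝ) ≤ k := by exact_mod_cast (hw.sig i).le
      gcongr
  have hlow : 1 < val ((k : ℝ) - 1) w := by
    have hb : 1 < (k : ℝ) - 1 := by linarith
    have h1 := val_step hb hw.sig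
    have h2 := val_pos hb (insigma_shift hw.sig 1) (nez_shift hn 1)
    simp only [Function.iterate_one] at h2
    rw [hw.head, Nat.cast_sub (by omega)] at h1
    push_cast at h1
    by_contra hc
    push Not at hc
    have : ((k:ℝ) - 1) * val ((k:ℝ)-1) w ≤ (k:ℝ) - 1 := by nlinarith
    linarith
  have hup : val (k : ℝ) w < 1 := by
    have hb : 1 < (k : ℝ) := by linarith
    have htop := qg_val hb (top_insigma hk) (qg_top hk)
    rw [← htop]
    obtain ⟨r, _, hr⟩ := hlt
    unfold val
    refine Summable.tsum_lt_tsum (i := r) (fun i => ?_) ?_ (val_summable hb hw.sig)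
      (val_summable hb (top_insigma hk))
    · show (w i : ℝ) * _ ≤ (topSeq k i : ℝ) * _
      have : (w i : ℝ) ≤ topSeq k i := by
        have := hw.sig i
        exact_mod_cast (show w i ≤ topSeq k i by unfold topSeq; omega)
      gcongr
    · have : (w r : ℝ) < topSeq k r := by exact_mod_cast hr
      gcongr
  obtain ⟨β, hβ, hv⟩ := intermediate_value_Ioo' (by linarith) hcont ⟨hup, hlow⟩
  have hb : 1 < β := by linarith [hβ.1]
  refine ⟨β, hβ.1, hβ.2, wbeta_eq hb (t := fun r => val β (shift^[r] w)) ⟨hv, fun r => ?_, fun r => ?_, fun r => ?_⟩⟩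
  · exact val_pos hb (insigma_shift hw.sig r) (nez_shift hn r)
  · refine parry hb hw.sig hv (insigma_shift hw.sig r) fun s => ?_
    rw [← Function.iterate_add_apply]; exact hw.max _
  · have := val_step' hb hw.sig r
    show val β (shift^[r+1] w) = _
    linarith

theorem exists_point {k : ℕ} (hk : 3 ≤ k) {β : ℝ} (h1 : (k : ℝ) - 1 < β) (h2 : β < k) {v : Seq}
    (hv : InSigma k v) (h : ∀ r, seqLt (shift^[r] v) (wbeta β)) :
    ∃ x ∈ Set.Icc (0 : ℝ) 1, dbeta β x = v := by
  have hb := base_gt_one hk h1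
  obtain ⟨t, ht⟩ := qg_wbeta hb
  have hw := qg_insigma h2 hb ht
  have hval := qg_val hb hw ht
  have hle : ∀ r, val β (shift^[r] v) ≤ 1 := fun r =>
    parry hb hw hval (insigma_shift hv r) fun s => by
      rw [← Function.iterate_add_apply]; exact Or.inl (h _)
  have hlt : ∀ r, val β (shift^[r] v) < 1 := by
    intro r
    obtain ⟨g, e1, e2⟩ := h r
    have ha := val_agree hb (insigma_shift hv r) hw e1
    rw [hval] at ha
    have s1 := val_step' hb (insigma_shift hv r) g
    have s2 := val_step' hb hw g
    have hp : 0 < val β (shift^[g+1] (wbeta β)) := by rw [qg_shift_val hb hw ht]; exact ht.pos _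
    have h_int1 : (shift^[r] v g : ℝ) + 1 ≤ wbeta β g := by exact_mod_cast e2
    have hl : val β (shift^[g+1] (shift^[r] v)) ≤ 1 := by
      rw [← Function.iterate_add_apply]; exact hle _
    have : β ^ (g + 1) * (val β (shift^[r] v) - 1) < 0 := by
      have : β ^ (g + 1) * (val β (shift^[r] v) - 1) = β * (β ^ g * (val β (shift^[r] v) - 1)) := by ring
      rw [this, ← ha]; linarith
    by_contra hc
    push Not at hc
    have : 0 ≤ β ^ (g + 1) * (val β (shift^[r] v) - 1) := mul_nonneg (by positivity) (by linarith)
    linarith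
  have hnn : ∀ r, 0 ≤ val β (shift^[r] v) := fun r => val_nonneg hb _
  have hfl : ∀ r, ⌊β * val β (shift^[r] v)⌋₊ = v r := by
    intro r
    rw [val_step' hb hv r, Nat.floor_eq_iff (by have := hnn (r+1); positivity)]
    have := hnn (r+1); have := hlt (r+1)
    constructor <;> linarith
  have horb : ∀ r, (fbeta β)^[r] (val β v) = val β (shift^[r] v) := by
    intro r
    induction r with
    | zero => rfl
    | succ r ih =>
      rw [fb_step (x := val β v) (show (0:ℝ) ≤ β by linarith) (val_nonneg hb v)]
      unfold dbeta
      rw [ih, hfl, val_step' hb hv r]; simp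
  refine ⟨val β v, ⟨hnn 0, (hlt 0).le⟩, ?_⟩
  funext r
  unfold dbeta
  rw [horb, hfl]

theorem dbeta_le {β : ℝ} (hb : 1 < β) {x : ℝ} (h0 : 0 ≤ x) (hx1 : x < 1) (r : ℕ) :
    seqLe (shift^[r] (dbeta β x)) (wbeta β) := by
  obtain ⟨t, ht⟩ := qg_wbeta hb
  set T : ℕ → ℝ := fun r => (fbeta β)^[r] x with hT
  have Tnn : ∀ r, 0 ≤ T r := fb_nonneg h0
  have Tlt : ∀ r, T r < 1 := fb_lt hx1
  have Tst : ∀ r, T (r + 1) = β * T r - dbeta β x r := fb_step (by linarith) h0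
  by_contra hc
  rw [not_seqLe] at hc
  obtain ⟨g, e1, e2⟩ := hc
  have hd : ∀ j, j ≤ g → T (j + r) < t j := by
    intro j hj
    induction j with
    | zero => rw [ht.zero]; exact Tlt _
    | succ j ih =>
      have := e1 j (by omega)
      rw [shift_iter_apply] at this
      rw [show j + 1 + r = (j + r) + 1 by omega, Tst, ht.step, this]
      have := ih (by omega)
      nlinarith
  rw [shift_iter_apply] at e2
  have h1 := hd g le_rfl
  have h2 := Tst (g + r)
  have h3 := ht.step g
  have h4 := ht.le (g + 1)
  have h5 := Tnn (g + r + 1)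
  have h_int1 : (wbeta β g : ℝ) + 1 ≤ dbeta β x (g + r) := by exact_mod_cast e2
  nlinarith

theorem dbeta_insigma {k : ℕ} {β : ℝ} (hb : 1 < β) (h2 : β < k) {x : ℝ} (h0 : 0 ≤ x) (h1 : x ≤ 1) :
    InSigma k (dbeta β x) := by
  intro r
  unfold dbeta
  rw [Nat.floor_lt (mul_nonneg (by linarith) (fb_nonneg h0 r))]
  have := fb_le (β := β) h1 r
  have := fb_nonneg (β := β) h0 r
  nlinarith

theorem dbeta_shift {β x : ℝ} : shift (dbeta β x) = dbeta β (fbeta β x) := by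
  funext r
  simp only [shift, dbeta, Function.iterate_succ_apply]

/-! ### The intervals -/

theorem mem_Iint {k : ℕ} (hk : 3 ≤ k) (f : ℕ → ℕ) (R : ℕ) (β : ℝ) :
    β ∈ Iint k f R ↔ (k : ℝ) - 1 < β ∧ β < k ∧ seqLe (loS k ((List.range R).map f) (f R)) (wbeta β) ∧
      seqLe (wbeta β) (hiS k ((List.range R).map f) (f R)) := by
  unfold Iint
  rw [Sseq_rat hk, SN_fin]; rfl

theorem part1 {k : ℕ} (hk : 3 ≤ k) (R : ℕ) (f : ℕ → ℕ) (R' : ℕ) (f' : ℕ → ℕ)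
    (h : ¬ (R = R' ∧ ∀ i ≤ R, f i = f' i)) : Disjoint (Iint k f R) (Iint k f' R') := by
  rw [Set.disjoint_left]
  intro β h1 h2
  rw [mem_Iint hk] at h1 h2
  have hne : (List.range R).map f ≠ (List.range R').map f' ∨ f R ≠ f' R' := by
    by_contra hc
    push Not at hc
    obtain ⟨hc1, hc2⟩ := hc
    have hl := congrArg List.length hc1
    simp at hl
    subst hl
    refine h ⟨rfl, fun i hi => ?_⟩
    rcases hi.lt_or_eq with hi | rfl
    · rw [List.map_inj_left] at hc1
      exact hc1 i (List.mem_range.2 hi)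
    · exact hc2
  rcases gaps_disjoint hk _ _ _ _ hne with hg | hg
  · exact seqLt_irrefl (seqLt_of_lt_of_le hg (seqLe_trans h2.2.2.1 h1.2.2.2))
  · exact seqLt_irrefl (seqLt_of_lt_of_le hg (seqLe_trans h1.2.2.1 h2.2.2.2))

theorem part2 {k : ℕ} (hk : 3 ≤ k) (R : ℕ) (f : ℕ → ℕ) : ∃ a b : ℝ,
      a < b ∧ (k : ℝ) - 1 < a ∧ b < (k : ℝ) ∧ Iint k f R = Set.Icc a b := by
  set l := (List.range R).map f with hl
  set n := f R with hn
  have hlt := lo_lt_hi hk l n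
  obtain ⟨a, ha1, ha2, hwa⟩ := exists_beta hk (good_lo hk l n) (nez_lo hk l n) (seqLt_trans hlt (hi_lt_top hk l n))
  obtain ⟨b, hb1, hb2, hwb⟩ := exists_beta hk (good_hi hk l n) (nez_hi hk l n) (hi_lt_top hk l n)
  have A := base_gt_one hk ha1
  have B := base_gt_one hk hb1
  refine ⟨a, b, ?_, ha1, hb2, ?_⟩
  · by_contra hc
    push Not at hc
    rw [← wbeta_le_iff B A, hwa, hwb] at hc
    exact seqLt_irrefl (seqLt_of_lt_of_le hlt hc)
  · ext β
    rw [mem_Iint hk, ← hl, ← hn, ← hwa, ← hwb]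
    constructor
    · rintro ⟨h1, h2, h3, h4⟩
      have C := base_gt_one hk h1
      exact ⟨(wbeta_le_iff A C).1 h3, (wbeta_le_iff C B).1 h4⟩
    · rintro ⟨h3, h4⟩
      have C : 1 < β := by linarith
      exact ⟨by linarith, by linarith, (wbeta_le_iff A C).2 h3, (wbeta_le_iff C B).2 h4⟩

/-! ### The complement has measure zero -/

theorem beta_close {k : ℕ} (hk : 3 ≤ k) {β β' : ℝ} (h1 : (k : ℝ) - 1 < β) (hlt : β < β') (h2 : β' < k)
    {N : ℕ} (ha : agree N (wbeta β) (wbeta β')) :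
    β' - β ≤ ((k : ℝ) - 1) * (((k : ℝ) - 1)⁻¹) ^ N := by
  have hk3 : (3 : ℝ) ≤ k := by exact_mod_cast hk
  have hb := base_gt_one hk h1
  have hk0 : (0 : ℝ) < (k : ℝ) - 1 := by linarith
  rcases N with _ | N
  · simp; linarith
  · obtain ⟨t, ht⟩ := qg_wbeta hb
    obtain ⟨t', ht'⟩ := qg_wbeta (hb.trans hlt)
    have h := qg_diam hb hlt ht ht' ha
    have hp : ((k : ℝ) - 1) ^ N ≤ β ^ N := by gcongr
    have h3 : ((k : ℝ) - 1) ^ N * (β' - β) ≤ 1 := by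
      have : ((k : ℝ) - 1) ^ N * (β' - β) ≤ β ^ N * (β' - β) := by
        apply mul_le_mul_of_nonneg_right hp; linarith
      linarith
    rw [pow_succ, mul_comm _ (((k : ℝ) - 1)⁻¹), ← mul_assoc, mul_inv_cancel₀ hk0.ne', one_mul, inv_pow,
      ← one_div, le_div_iff₀ (by positivity)]
    linarith

theorem beta_close' {k : ℕ} (hk : 3 ≤ k) {β β' : ℝ} (h1 : (k : ℝ) - 1 < β) (h1' : (k : ℝ) - 1 < β')
    (h2 : β < k) (h2' : β' < k) {N : ℕ} (ha : agree N (wbeta β) (wbeta β')) :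
    dist β β' ≤ ((k : ℝ) - 1) * (((k : ℝ) - 1)⁻¹) ^ N := by
  rcases lt_trichotomy β β' with h | rfl | h
  · rw [dist_comm, Real.dist_eq, abs_of_pos (by linarith)]; exact beta_close hk h1 h h2' ha
  · rw [dist_self]
    have hk3 : (3 : ℝ) ≤ k := by exact_mod_cast hk
    have hk0 : (0 : ℝ) < (k : ℝ) - 1 := by linarith
    positivity
  · rw [Real.dist_eq, abs_of_pos (by linarith)]; exact beta_close hk h1' h h2 ha.symm

theorem rho_lt {k : ℕ} (hk : 3 ≤ k) {m : ℕ} (hm : 1 ≤ m) :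
    ∑ d : Fin k, (((k : ℝ) - 1)⁻¹) ^ (lamWord k m d).length < 1 := by
  have hk3 : (3 : ℝ) ≤ k := by exact_mod_cast hk
  set x := ((k : ℝ) - 1)⁻¹ with hx
  have hk0 : (0 : ℝ) < (k : ℝ) - 1 := by linarith
  have hx0 : 0 < x := by positivity
  have hx1 : x ≤ 1 / 2 := by
    rw [hx, ← one_div]; exact one_div_le_one_div_of_le (by norm_num) (by linarith)
  have hkx : ((k : ℝ) - 1) * x = 1 := mul_inv_cancel₀ hk0.ne'
  clear_value x
  obtain ⟨j, rfl⟩ : ∃ j, k = j + 2 := ⟨k - 2, by omega⟩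
  rw [Fin.sum_univ_castSucc, Fin.sum_univ_castSucc]
  have h1 : ∀ i : Fin j, x ^ (lamWord (j + 2) m ((i.castSucc.castSucc : Fin (j + 2)) : ℕ)).length = x := by
    intro i
    have := i.2
    rw [lamWord_lo (by simp)]; simp
  rw [Finset.sum_congr rfl (fun i _ => h1 i)]
  have h2 : (lamWord (j + 2) m (((Fin.last j).castSucc : Fin (j + 2)) : ℕ)).length = m + 2 := by
    rw [lamWord_mid (by simp)]; simp
  have h3 : (lamWord (j + 2) m ((Fin.last (j+1) : Fin (j + 2)) : ℕ)).length = m + 1 := by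
    rw [lamWord_hi (by simp)]; simp
  rw [h2, h3]
  simp only [Finset.sum_const, Finset.card_univ, Fintype.card_fin, nsmul_eq_mul]
  push_cast at hkx
  have e1 : x ^ (m + 2) ≤ x ^ 3 := pow_le_pow_of_le_one hx0.le (by linarith) (by omega)
  have e2 : x ^ (m + 1) ≤ x ^ 2 := pow_le_pow_of_le_one hx0.le (by linarith) (by omega)
  have e3 : x ^ 2 ≤ x * (1/2) := by nlinarith
  have e4 : x ^ 3 ≤ x * (1/4) := by nlinarith
  nlinarith

/-- the exceptional set attached to `s` and `m` -/
def Zset (k s m : ℕ) : Set ℝ := {β | (k : ℝ) - 1 < β ∧ β < k ∧ ∀ M, ∃ v, InSigma k v ∧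
      agree M (wbeta β) (lamList k (List.replicate s 0) (lamSub k m v))}

theorem zset_bound {k : ℕ} (hk : 3 ≤ k) (s : ℕ) (m : ℕ) (L : ℕ) :
    MeasureTheory.volume (Zset k s m) ≤ ENNReal.ofReal (((k : ℝ) - 1) *
      (∑ d : Fin k, (((k : ℝ) - 1)⁻¹) ^ (lamWord k m d).length) ^ L) := by
  have hk3 : (3 : ℝ) ≤ k := by exact_mod_cast hk
  set x := ((k : ℝ) - 1)⁻¹ with hx
  have hk0 : (0 : ℝ) < (k : ℝ) - 1 := by linarith
  have hx0 : 0 < x := by positivity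
  set N : (Fin L → Fin k) → ℕ := fun u => ∑ i, (lamWord k m (u i)).length with hN
  set A : (Fin L → Fin k) → Set ℝ := fun u => {β | (k : ℝ) - 1 < β ∧ β < k ∧ ∃ v, InSigma k v ∧
    (∀ i : Fin L, v i = u i) ∧ agree (N u) (wbeta β) (lamList k (List.replicate s 0) (lamSub k m v))} with hA
  have hlp : ∀ (u : Fin L → Fin k) (v : Seq), (∀ i : Fin L, v i = u i) → lpos k m v L = N u := by
    intro u v hv
    unfold lpos pos
    rw [Finset.sum_range]
    exact Finset.sum_congr rfl fun i _ => by simp only [hv i]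
  have hcov : Zset k s m ⊆ ⋃ u, A u := by
    rintro β ⟨h1, h2, h3⟩
    obtain ⟨v, hv, ha⟩ := h3 (L * (m + 2))
    refine Set.mem_iUnion.2 ⟨fun i => ⟨v i, hv i⟩, h1, h2, v, hv, fun i => rfl, ha.mono ?_⟩
    have : ∀ i ∈ (Finset.univ : Finset (Fin L)), (lamWord k m (v i)).length ≤ m + 2 := by
      intro i _
      unfold lamWord
      split_ifs <;> simp
    refine (Finset.sum_le_sum this).trans ?_
    simp
  have hvol : ∀ u, MeasureTheory.volume (A u) ≤ ENNReal.ofReal (((k : ℝ) - 1) * x ^ (N u)) := by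
    intro u
    refine (Real.volume_le_diam _).trans (Metric.ediam_le_of_forall_dist_le ?_)
    rintro β ⟨h1, h2, v, hv, hu, ha⟩ β' ⟨h1', h2', v', hv', hu', ha'⟩
    refine beta_close' hk h1 h1' h2 h2' ?_
    have hag : agree L v v' := by
      intro i hi
      have e1 := hu ⟨i, hi⟩
      have e2 := hu' ⟨i, hi⟩
      simp only at e1 e2
      rw [e1, e2]
    have := (lam_agree (k := k) (n := m) hag).2
    rw [hlp u v hu] at this
    exact ha.trans ((lamList_agree (k := k) (List.replicate s 0) this).trans ha'.symm)
  calc MeasureTheory.volume (Zset k s m) ≤ MeasureTheory.volume (⋃ u, A u) := MeasureTheory.measure_mono hcov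
    _ ≤ ∑ u, MeasureTheory.volume (A u) := MeasureTheory.measure_iUnion_fintype_le _ _
    _ ≤ ∑ u, ENNReal.ofReal (((k : ℝ) - 1) * x ^ (N u)) := Finset.sum_le_sum fun u _ => hvol u
    _ = ENNReal.ofReal (∑ u, ((k : ℝ) - 1) * x ^ (N u)) := by
        rw [ENNReal.ofReal_sum_of_nonneg]; intro u _; positivity
    _ = _ := by
        rw [← Finset.mul_sum, Fintype.sum_pow]
        congr 2
        refine Finset.sum_congr rfl fun u _ => ?_
        rw [Finset.prod_pow_eq_pow_sum]

theorem zset_null {k : ℕ} (hk : 3 ≤ k) (s : ℕ) {m : ℕ} (hm : 1 ≤ m) :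
    MeasureTheory.volume (Zset k s m) = 0 := by
  have hk3 : (3 : ℝ) ≤ k := by exact_mod_cast hk
  have hk0 : (0 : ℝ) < (k : ℝ) - 1 := by linarith
  have hr := rho_lt hk hm
  have hb := fun L => zset_bound hk s m L
  set ρ := ∑ d : Fin k, (((k : ℝ) - 1)⁻¹) ^ (lamWord k m d).length with hρ
  have hρ0 : 0 ≤ ρ := Finset.sum_nonneg fun i _ => by positivity
  have ht : Tendsto (fun L : ℕ => ENNReal.ofReal (((k : ℝ) - 1) * ρ ^ L)) atTop (𝓝 0) := by
    rw [← ENNReal.ofReal_zero]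
    apply ENNReal.tendsto_ofReal
    have := (tendsto_pow_atTop_nhds_zero_of_lt_one hρ0 hr).const_mul ((k : ℝ) - 1)
    simpa using this
  exact le_antisymm (ge_of_tendsto' ht hb) zero_le

theorem part3 {k : ℕ} (hk : 3 ≤ k) :
    MeasureTheory.volume (Set.Ioo ((k : ℝ) - 1) (k : ℝ) \ ⋃ (R : ℕ) (f : ℕ → ℕ), Iint k f R) = 0 := by
  have hsub : Set.Ioo ((k : ℝ) - 1) (k : ℝ) \ ⋃ (R : ℕ) (f : ℕ → ℕ), Iint k f R ⊆
      ⋃ s : ℕ, ⋃ m : ℕ, Zset k s (m + 1) := by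
    rintro β ⟨⟨h1, h2⟩, h3⟩
    have hgap : ∀ l n, ¬ (seqLe (loS k l n) (wbeta β) ∧ seqLe (wbeta β) (hiS k l n)) := by
      rintro l n ⟨e1, e2⟩
      refine h3 (Set.mem_iUnion.2 ⟨l.length, Set.mem_iUnion.2 ⟨fun i => (l ++ [n]).getD i 0, ?_⟩⟩)
      rw [mem_Iint hk]
      have hl : (List.range l.length).map (fun i => (l ++ [n]).getD i 0) = l := by
        apply List.ext_getElem
        · simp
        · intro i hi hi'
          simp [List.getElem?_append_left hi', List.getElem?_eq_getElem hi']
      have hn : (l ++ [n]).getD l.length 0 = n := by simp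
      rw [hl, hn]
      exact ⟨h1, h2, e1, e2⟩
    obtain ⟨s, m, hm, h⟩ := btw_seq hk hgap (base_lt_wbeta hk h1 h2) (wbeta_lt_top hk h1 h2)
    obtain ⟨m, rfl⟩ : ∃ m', m = m' + 1 := ⟨m - 1, by omega⟩
    exact Set.mem_iUnion.2 ⟨s, Set.mem_iUnion.2 ⟨m, h1, h2, h⟩⟩
  refine MeasureTheory.measure_mono_null hsub ?_
  rw [MeasureTheory.measure_iUnion_null_iff]
  intro s
  rw [MeasureTheory.measure_iUnion_null_iff]
  intro m
  exact zset_null hk s (by omega)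

/-! ### The cones -/

/-- the abelianization of `Λ_n` -/
def Mn (k n : ℕ) (a : ℕ → ℝ) (i : ℕ) : ℝ :=
  if i = 0 then ((n : ℝ) + 1) * a (k - 2) + n * a (k - 1)
  else if i + 1 = k then a (k - 2) + a (k - 1)
  else a (i - 1)

/-- integer version of `Mn` -/
def MnN (k n : ℕ) (a : ℕ → ℕ) (i : ℕ) : ℕ :=
  if i = 0 then (n + 1) * a (k - 2) + n * a (k - 1)
  else if i + 1 = k then a (k - 2) + a (k - 1)
  else a (i - 1)

/-- the cone of admissible frequency vectors -/
def InCone (k : ℕ) : List ℕ → (ℕ → ℝ) → Prop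
  | [], a => (∀ i < k, 0 ≤ a i) ∧ a (k - 1) = 0
  | n :: t, a => ∃ c a', 0 ≤ c ∧ InCone k t a' ∧
      ∀ i < k, a i = (if i = 0 then c else 0) + Mn k n a' i

theorem inCone_gen {k : ℕ} (hk : 3 ≤ k) (l : List ℕ) :
    ∃ (N : ℕ) (g : Fin N → ℕ → ℕ), (∀ j, ∃ i < k, g j i ≠ 0) ∧
      ∀ a : ℕ → ℝ, InCone k l a ↔ ∃ c : Fin N → ℝ, (∀ j, 0 ≤ c j) ∧ ∀ i < k, a i = ∑ j, c j * (g j i : ℝ) := by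
  induction l with
  | nil =>
    refine ⟨k - 1, fun j i => if i = (j : ℕ) then 1 else 0, fun j => ⟨j, by omega, by simp⟩, fun a => ?_⟩
    have hs : ∀ (c : Fin (k - 1) → ℝ) (i : ℕ), ∑ j, c j * (((if i = (j : ℕ) then 1 else 0 : ℕ)) : ℝ) =
        if h : i < k - 1 then c ⟨i, h⟩ else 0 := by
      intro c i
      split_ifs with h
      · rw [Finset.sum_eq_single (⟨i, h⟩ : Fin (k - 1))]
        · simp
        · intro b _ hb
          rw [if_neg (fun he => hb (Fin.ext he.symm))]; simp
        · simp
      · refine Finset.sum_eq_zero fun j _ => ?_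
        rw [if_neg (by have := j.2; omega)]; simp
    constructor
    · rintro ⟨h1, h2⟩
      refine ⟨fun j => a j, fun j => h1 _ (by omega), fun i hi => ?_⟩
      rw [hs]
      split_ifs with h
      · rfl
      · rw [show i = k - 1 by omega, h2]
    · rintro ⟨c, hc, h⟩
      refine ⟨fun i hi => ?_, ?_⟩
      · rw [h i hi]; exact Finset.sum_nonneg fun j _ => mul_nonneg (hc j) (Nat.cast_nonneg _)
      · rw [h _ (by omega), hs, dif_neg (by omega)]
  | cons n t ih =>
    obtain ⟨N, g, hg, hiff⟩ := ih
    refine ⟨N + 1, Fin.cons (fun i => if i = 0 then 1 else 0) (fun j => MnN k n (g j)), ?_, fun a => ?_⟩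
    · intro j
      refine Fin.cases ?_ (fun j => ?_) j
      · exact ⟨0, by omega, by simp⟩
      · obtain ⟨i, hi, hne⟩ := hg j
        simp only [Fin.cons_succ]
        by_cases h : i + 2 < k
        · refine ⟨i + 1, by omega, ?_⟩
          unfold MnN
          rw [if_neg (by omega), if_neg (by omega)]; simpa using hne
        · refine ⟨k - 1, by omega, ?_⟩
          unfold MnN
          rw [if_neg (by omega), if_pos (by omega)]
          rcases (show i = k - 2 ∨ i = k - 1 by omega) with rfl | rfl <;> omega
    · have hM : ∀ (c : Fin N → ℝ) (a' : ℕ → ℝ), (∀ i < k, a' i = ∑ j, c j * (g j i : ℝ)) →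
          ∀ i < k, Mn k n a' i = ∑ j, c j * (MnN k n (g j) i : ℝ) := by
        intro c a' h i hi
        unfold Mn MnN
        split_ifs
        · rw [h _ (by omega), h _ (by omega), Finset.mul_sum, Finset.mul_sum, ← Finset.sum_add_distrib]
          refine Finset.sum_congr rfl fun j _ => ?_
          push_cast; ring
        · rw [h _ (by omega), h _ (by omega), ← Finset.sum_add_distrib]
          refine Finset.sum_congr rfl fun j _ => ?_
          push_cast; ring
        · exact h _ (by omega)
      constructor
      · rintro ⟨c0, a', hc0, ha', h⟩
        obtain ⟨c, hc, h'⟩ := (hiff a').1 ha'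
        refine ⟨Fin.cons c0 c, ?_, fun i hi => ?_⟩
        · intro j; refine Fin.cases ?_ (fun j => ?_) j
          · simpa using hc0
          · simpa using hc j
        · rw [Fin.sum_univ_succ, h i hi, hM c a' h' i hi]
          simp
      · rintro ⟨c, hc, h⟩
        refine ⟨c 0, fun i => ∑ j, c (Fin.succ j) * (g j i : ℝ), hc 0, (hiff _).2 ⟨fun j => c (Fin.succ j), fun j => hc _, fun i _ => rfl⟩, fun i hi => ?_⟩
        rw [h i hi, Fin.sum_univ_succ, hM (fun j => c (Fin.succ j)) _ (fun _ _ => rfl) i hi]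
        simp

theorem inCone_nonneg {k : ℕ} (hk : 3 ≤ k) {l : List ℕ} {a : ℕ → ℝ} (h : InCone k l a) {i : ℕ} (hi : i < k) : 0 ≤ a i := by
  obtain ⟨N, g, _, hiff⟩ := inCone_gen hk l
  obtain ⟨c, hc, h⟩ := (hiff a).1 h
  rw [h i hi]; exact Finset.sum_nonneg fun j _ => mul_nonneg (hc j) (Nat.cast_nonneg _)

theorem inCone_smul {k : ℕ} (hk : 3 ≤ k) {l : List ℕ} {a b : ℕ → ℝ} (h : InCone k l a) {x : ℝ} (hx : 0 ≤ x)
    (hb : ∀ i < k, b i = x * a i) : InCone k l b := by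
  obtain ⟨N, g, _, hiff⟩ := inCone_gen hk l
  obtain ⟨c, hc, h⟩ := (hiff a).1 h
  refine (hiff b).2 ⟨fun j => x * c j, fun j => mul_nonneg hx (hc j), fun i hi => ?_⟩
  rw [hb i hi, h i hi, Finset.mul_sum]
  exact Finset.sum_congr rfl fun j _ => by ring

theorem Mn_drop {k : ℕ} (hk : 3 ≤ k) (n : ℕ) (a : ℕ → ℝ) {i : ℕ} (hi : i < k) :
    a i = (if i = 0 then a 0 - (n + 1) * a (k - 1) else 0) +
      Mn k n (fun i => if i + 1 < k then a (i + 1) else 0) i := by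
  unfold Mn
  have e : k - 2 + 1 = k - 1 := by omega
  have h1 : (if k - 2 + 1 < k then a (k - 2 + 1) else 0) = a (k - 1) := by rw [if_pos (by omega), e]
  have h2 : (if k - 1 + 1 < k then a (k - 1 + 1) else 0) = 0 := by rw [if_neg (by omega)]
  simp only [h1, h2]
  rcases Nat.eq_zero_or_pos i with rfl | hi0
  · simp only [if_true]; ring
  · rw [if_neg (by omega), if_neg (by omega)]
    by_cases h3 : i + 1 = k
    · rw [if_pos h3, show i = k - 1 by omega]; ring
    · rw [if_neg h3, Nat.sub_add_cancel hi0, if_pos hi]; ring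

theorem inCone_easy {k : ℕ} (hk : 3 ≤ k) (n : ℕ) (t : List ℕ) {a : ℕ → ℝ} (h : ∀ i < k, 0 ≤ a i)
    (h0 : ((n : ℝ) + 1) * a (k - 1) ≤ a 0) : InCone k (n :: t) a := by
  induction t generalizing n a with
  | nil =>
    refine ⟨a 0 - (n + 1) * a (k - 1), fun i => if i + 1 < k then a (i + 1) else 0, by linarith, ⟨?_, ?_⟩, ?_⟩
    · intro i hi
      show 0 ≤ if i + 1 < k then a (i + 1) else 0
      split_ifs with h'
      · exact h _ h'
      · exact le_rfl
    · show (if k - 1 + 1 < k then a (k - 1 + 1) else 0) = 0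
      rw [if_neg (by omega)]
    · intro i hi; exact Mn_drop hk n a hi
  | cons m t ih =>
    refine ⟨a 0 - (n + 1) * a (k - 1), fun i => if i + 1 < k then a (i + 1) else 0, by linarith, ih m ?_ ?_, ?_⟩
    · intro i hi
      show 0 ≤ if i + 1 < k then a (i + 1) else 0
      split_ifs with h'
      · exact h _ h'
      · exact le_rfl
    · show _ * (if k - 1 + 1 < k then a (k - 1 + 1) else 0) ≤ if 0 + 1 < k then a (0 + 1) else 0
      rw [if_neg (by omega), if_pos (by omega), mul_zero]; exact h _ (by omega)
    · intro i hi; exact Mn_drop hk n a hi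

theorem proj_fin {k : ℕ} (α : E k) (i : Fin k) : proj α i = α i := by
  simp [proj]

theorem inCone_hull {k : ℕ} (hk : 3 ≤ k) (l : List ℕ) : ∃ V : Finset (E k),
    (∀ v ∈ V, v ∈ simplex k ∧ ∀ i : Fin k, ∃ q : ℚ, v i = (q : ℝ)) ∧
    ∀ α : E k, α ∈ convexHull ℝ (V : Set (E k)) ↔ α ∈ simplex k ∧ InCone k l (proj α) := by
  obtain ⟨N, g, hg, hiff⟩ := inCone_gen hk l
  set tot : Fin N → ℕ := fun j => ∑ i : Fin k, g j i with htot
  have hpos : ∀ j, 0 < tot j := by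
    intro j
    obtain ⟨i, hi, hne⟩ := hg j
    exact Finset.sum_pos' (fun _ _ => Nat.zero_le _) ⟨⟨i, hi⟩, Finset.mem_univ _, Nat.pos_of_ne_zero hne⟩
  set p : Fin N → E k := fun j => (WithLp.equiv 2 (Fin k → ℝ)).symm fun i => (g j i : ℝ) / tot j with hp
  have hpi : ∀ j (i : Fin k), p j i = (g j i : ℝ) / tot j := fun j i => rfl
  have hiff' : ∀ α : E k, InCone k l (proj α) ↔ ∃ c : Fin N → ℝ, (∀ j, 0 ≤ c j) ∧ α = ∑ j, c j • p j := by
    intro α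
    rw [hiff]
    constructor
    · rintro ⟨c, hc, h⟩
      refine ⟨fun j => c j * tot j, fun j => mul_nonneg (hc j) (Nat.cast_nonneg _), ?_⟩
      ext i
      rw [← proj_fin, h i i.2]
      simp only [WithLp.ofLp_sum, WithLp.ofLp_smul, Finset.sum_apply, Pi.smul_apply, smul_eq_mul]
      refine Finset.sum_congr rfl fun j _ => ?_
      rw [hpi]
      have : (tot j : ℝ) ≠ 0 := by exact_mod_cast (hpos j).ne'
      field_simp
    · rintro ⟨c, hc, rfl⟩
      refine ⟨fun j => c j / tot j, fun j => div_nonneg (hc j) (Nat.cast_nonneg _), fun i hi => ?_⟩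
      rw [← Fin.val_mk hi, proj_fin]
      simp only [WithLp.ofLp_sum, WithLp.ofLp_smul, Finset.sum_apply, Pi.smul_apply, smul_eq_mul]
      refine Finset.sum_congr rfl fun j _ => ?_
      rw [hpi]; ring
  have hps : ∀ j, ∑ i, p j i = 1 := by
    intro j
    simp only [hpi]
    rw [← Finset.sum_div, ← Nat.cast_sum]
    exact div_self (by exact_mod_cast (hpos j).ne')
  have hsimp : ∀ j, p j ∈ simplex k := fun j =>
    ⟨fun i => by rw [hpi]; positivity, hps j⟩
  refine ⟨Finset.univ.image p, ?_, ?_⟩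
  · intro v hv
    obtain ⟨j, _, rfl⟩ := Finset.mem_image.1 hv
    exact ⟨hsimp j, fun i => ⟨(g j i : ℚ) / tot j, by rw [hpi]; push_cast; rfl⟩⟩
  · intro α
    constructor
    · intro hα
      have hconv : Convex ℝ {α : E k | α ∈ simplex k ∧ InCone k l (proj α)} := by
        rintro x ⟨⟨hx1, hx2⟩, hx3⟩ y ⟨⟨hy1, hy2⟩, hy3⟩ a b ha hb hab
        refine ⟨⟨fun i => ?_, ?_⟩, ?_⟩
        · have := hx1 i; have := hy1 i
          simp only [WithLp.ofLp_add, WithLp.ofLp_smul, Pi.add_apply, Pi.smul_apply, smul_eq_mul]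
          positivity
        · simp only [WithLp.ofLp_add, WithLp.ofLp_smul, Pi.add_apply, Pi.smul_apply, smul_eq_mul]
          rw [Finset.sum_add_distrib, ← Finset.mul_sum, ← Finset.mul_sum, hx2, hy2]; linarith
        · rw [hiff'] at *
          obtain ⟨c, hc, rfl⟩ := hx3
          obtain ⟨d, hd, rfl⟩ := hy3
          refine ⟨fun j => a * c j + b * d j, fun j => by have := hc j; have := hd j; positivity, ?_⟩
          rw [Finset.smul_sum, Finset.smul_sum, ← Finset.sum_add_distrib]
          refine Finset.sum_congr rfl fun j _ => ?_
          rw [add_smul, mul_smul, mul_smul]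
      refine convexHull_min ?_ hconv hα
      intro v hv
      obtain ⟨j, _, rfl⟩ := Finset.mem_image.1 (Finset.mem_coe.1 hv)
      refine ⟨hsimp j, (hiff' _).2 ⟨fun i => if i = j then 1 else 0, fun i => by show (0:ℝ) ≤ if i = j then 1 else 0; split_ifs <;> norm_num, ?_⟩⟩
      simp
    · rintro ⟨⟨h1, h2⟩, h3⟩
      obtain ⟨c, hc, rfl⟩ := (hiff' _).1 h3
      refine (convex_convexHull ℝ _).sum_mem (fun j _ => hc j) ?_ (fun j _ => subset_convexHull ℝ _ ?_)
      · have : ∑ i, (∑ j, c j • p j) i = ∑ j, c j := by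
          simp only [WithLp.ofLp_sum, WithLp.ofLp_smul, Finset.sum_apply, Pi.smul_apply, smul_eq_mul]
          rw [Finset.sum_comm]
          refine Finset.sum_congr rfl fun j _ => ?_
          rw [← Finset.mul_sum, hps, mul_one]
        rw [← this]; exact h2
      · simp

/-! ### Digit frequencies -/

/-- digit frequencies, with a plain function as frequency vector -/
def HF (k : ℕ) (w : Seq) (a : ℕ → ℝ) : Prop :=
  ∀ i, i < k → Tendsto (fun r => (digitCount w i r : ℝ) / (r : ℝ)) atTop (𝓝 (a i))

theorem digitCount_succ (w : Seq) (i r : ℕ) :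
    digitCount w i (r + 1) = digitCount w i r + if w r = i then 1 else 0 := by
  unfold digitCount
  rw [Finset.range_add_one, Finset.filter_insert]
  split_ifs with h
  · rw [Finset.card_insert_of_notMem (by simp)]
  · simp

theorem digitCount_zero (w : Seq) (i : ℕ) : digitCount w i 0 = 0 := by simp [digitCount]

theorem digitCount_add (w : Seq) (i p j : ℕ) :
    digitCount w i (p + j) = digitCount w i p + digitCount (shift^[p] w) i j := by
  induction j with
  | zero => simp [digitCount_zero]
  | succ j ih =>
    rw [← Nat.add_assoc, digitCount_succ, ih, digitCount_succ, shift_iter_apply, Nat.add_comm j p]; omega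

theorem digitCount_mono (w : Seq) (i : ℕ) {p q : ℕ} (h : p ≤ q) : digitCount w i p ≤ digitCount w i q := by
  obtain ⟨j, rfl⟩ := Nat.exists_eq_add_of_le h
  rw [digitCount_add]; omega

theorem digitCount_le (w : Seq) (i r : ℕ) : digitCount w i r ≤ r := by
  unfold digitCount
  exact (Finset.card_filter_le _ _).trans (by simp)

theorem digitCount_total {k : ℕ} {w : Seq} (hw : InSigma k w) (r : ℕ) :
    ∑ i ∈ Finset.range k, digitCount w i r = r := by
  induction r with
  | zero => simp [digitCount_zero]
  | succ r ih =>
    simp only [digitCount_succ]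
    rw [Finset.sum_add_distrib, ih, Finset.sum_ite_eq, if_pos (by simpa using hw r)]

theorem digitCount_eq_count (w : Seq) (i r : ℕ) : digitCount w i r = ((List.range r).map w).count i := by
  induction r with
  | zero => simp [digitCount_zero]
  | succ r ih =>
    rw [digitCount_succ, ih, List.range_succ, List.map_append, List.count_append]
    simp [List.count_singleton]

theorem digitCount_app (l : List ℕ) (w : Seq) (i : ℕ) : digitCount (app l w) i l.length = l.count i := by
  rw [digitCount_eq_count]
  congr 1
  apply List.ext_getElem
  · simp
  · intro j h1 h2
    simp [app_lt l w h2]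

theorem digitCount_cat {B : ℕ → List ℕ} (hB : ∀ j, B j ≠ []) (i q : ℕ) :
    digitCount (cat B) i (pos B q) = ∑ j ∈ Finset.range q, (B j).count i := by
  induction q with
  | zero => simp [pos_zero, digitCount_zero]
  | succ q ih =>
    rw [pos_succ, digitCount_add, ih, Finset.sum_range_succ, cat_shift hB,
      cat_cons (B := fun i => B (i + q)) (fun _ => hB _)]
    have := digitCount_app (B (0 + q)) (cat fun i => B (i + 1 + q)) i
    simp only [Nat.zero_add] at this ⊢
    rw [this]

theorem div_shift {C : ℕ → ℝ} {κ : ℝ} (h : Tendsto (fun q : ℕ => C q / (q : ℝ)) atTop (𝓝 κ)) :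
    Tendsto (fun q : ℕ => C (q + 1) / (q : ℝ)) atTop (𝓝 κ) := by
  have h1 := (tendsto_add_atTop_iff_nat 1).2 h
  have h2 : Tendsto (fun q : ℕ => ((q : ℝ) + 1) / (q : ℝ)) atTop (𝓝 1) := by
    have : Tendsto (fun q : ℕ => 1 + 1 / (q : ℝ)) atTop (𝓝 (1 + 0)) :=
      tendsto_const_nhds.add tendsto_one_div_atTop_nhds_zero_nat
    rw [add_zero] at this
    refine this.congr' ?_
    filter_upwards [eventually_gt_atTop 0] with q hq
    have : (q : ℝ) ≠ 0 := by positivity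
    field_simp
  have := h1.mul h2
  rw [mul_one] at this
  refine this.congr' ?_
  filter_upwards [eventually_gt_atTop 0] with q hq
  have : (q : ℝ) ≠ 0 := by positivity
  have : (q : ℝ) + 1 ≠ 0 := by positivity
  push_cast
  field_simp

/-- sampling a monotone count along blocks -/
theorem freq_sample {D : ℕ → ℕ} (hD : Monotone D) {p : ℕ → ℕ} (hp : Monotone p) (hp0 : p 0 = 0)
    (hpt : Tendsto p atTop atTop) {κ ℓ : ℝ} (hℓ : 0 < ℓ)
    (h1 : Tendsto (fun q : ℕ => (p q : ℝ) / (q : ℝ)) atTop (𝓝 ℓ))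
    (h2 : Tendsto (fun q : ℕ => (D (p q) : ℝ) / (q : ℝ)) atTop (𝓝 κ)) :
    Tendsto (fun r : ℕ => (D r : ℝ) / (r : ℝ)) atTop (𝓝 (κ / ℓ)) := by
  have hex : ∀ r, ∃ q, p q ≤ r ∧ r < p (q + 1) := by
    intro r
    have he : ∃ q, r < p q := ((hpt.eventually_gt_atTop r).exists)
    have hs := Nat.find_spec he
    have hm := fun m => Nat.find_min he (m := m)
    rcases hf : Nat.find he with _ | q
    · rw [hf, hp0] at hs; omega
    · rw [hf] at hs hm
      exact ⟨q, by simpa using hm q (by omega), hs⟩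
  choose q hq1 hq2 using hex
  have hqt : Tendsto q atTop atTop := by
    rw [tendsto_atTop_atTop]
    intro Q
    refine ⟨p Q, fun r hr => ?_⟩
    by_contra hc
    push Not at hc
    have := hp (show q r + 1 ≤ Q from hc)
    have := hq2 r
    omega
  have lo : Tendsto (fun q : ℕ => (D (p q) : ℝ) / (p (q + 1) : ℝ)) atTop (𝓝 (κ / ℓ)) := by
    have := h2.div (div_shift (C := fun q => (p q : ℝ)) h1) hℓ.ne'
    refine this.congr' ?_
    filter_upwards [eventually_gt_atTop 0] with q hq
    have : (q : ℝ) ≠ 0 := by positivity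
    simp only [Pi.div_apply]
    exact div_div_div_cancel_right₀ this _ _
  have hi : Tendsto (fun q : ℕ => (D (p (q + 1)) : ℝ) / (p q : ℝ)) atTop (𝓝 (κ / ℓ)) := by
    have := (div_shift (C := fun q => (D (p q) : ℝ)) h2).div h1 hℓ.ne'
    refine this.congr' ?_
    filter_upwards [eventually_gt_atTop 0] with q hq
    have : (q : ℝ) ≠ 0 := by positivity
    simp only [Pi.div_apply]
    exact div_div_div_cancel_right₀ this _ _
  refine tendsto_of_tendsto_of_tendsto_of_le_of_le' (lo.comp hqt) (hi.comp hqt) ?_ ?_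
  · filter_upwards [eventually_gt_atTop 0] with r hr
    simp only [Function.comp]
    have a1 : (D (p (q r)) : ℝ) ≤ D r := by exact_mod_cast hD (hq1 r)
    have a2 : (r : ℝ) ≤ p (q r + 1) := by exact_mod_cast (hq2 r).le
    have a3 : (0 : ℝ) < r := by exact_mod_cast hr
    gcongr
  · filter_upwards [eventually_ge_atTop (p 0 + 1), (hpt.comp hqt).eventually_gt_atTop 0] with r hr hr'
    simp only [Function.comp] at hr' ⊢
    have a1 : (D r : ℝ) ≤ D (p (q r + 1)) := by exact_mod_cast hD (hq2 r).le
    have a2 : (p (q r) : ℝ) ≤ r := by exact_mod_cast hq1 r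
    have a3 : (0 : ℝ) < p (q r) := by exact_mod_cast hr'
    gcongr

/-! ### Realizing frequencies: base case -/

theorem greedy_exists {k : ℕ} {a : ℕ → ℝ} (ha : ∀ i < k, 0 ≤ a i) (hs : ∑ i ∈ Finset.range k, a i = 1) :
    ∃ v : Seq, InSigma k v ∧ (∀ r, a (v r) ≠ 0) ∧ HF k v a := by
  let pick : (ℕ → ℕ) → ℕ → ℕ := fun N m =>
    if h : ∃ i, i < k ∧ (N i : ℝ) < a i * (m + 1) then h.choose else 0
  obtain ⟨C, C0, Cs⟩ : ∃ C : ℕ → ℕ → ℕ, C 0 = (fun _ => 0) ∧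
      ∀ m, C (m + 1) = fun i => C m i + if pick (C m) m = i then 1 else 0 :=
    ⟨fun m => Nat.rec (motive := fun _ => ℕ → ℕ) (fun _ => 0)
      (fun m N => fun i => N i + if pick N m = i then 1 else 0) m, rfl, fun m => rfl⟩
  let v : Seq := fun m => pick (C m) m
  have hcnt : ∀ m i, digitCount v i m = C m i := by
    intro m i
    induction m with
    | zero => simp [digitCount_zero, C0]
    | succ m ih => rw [digitCount_succ, ih, Cs]
  have main : ∀ m : ℕ, (∑ i ∈ Finset.range k, C m i = m) ∧ (v m < k ∧ ((C m (v m) : ℕ) : ℝ) < a (v m) * (m + 1)) := by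
    intro m
    have hpick : ∀ m : ℕ, (∑ i ∈ Finset.range k, C m i = m) → (v m < k ∧ ((C m (v m) : ℕ) : ℝ) < a (v m) * (m + 1)) := by
      intro m hm
      have hex : ∃ i, i < k ∧ (C m i : ℝ) < a i * (m + 1) := by
        by_contra hc
        push Not at hc
        have h1 : ∑ i ∈ Finset.range k, a i * ((m : ℝ) + 1) ≤ ∑ i ∈ Finset.range k, (C m i : ℝ) :=
          Finset.sum_le_sum fun i hi => hc i (by simpa using hi)
        rw [← Finset.sum_mul, hs, ← Nat.cast_sum, hm] at h1
        linarith
      have : v m = hex.choose := by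
        show pick (C m) m = _
        simp only [pick]; rw [dif_pos hex]
      rw [this]; exact hex.choose_spec
    have hsum : ∑ i ∈ Finset.range k, C m i = m := by
      induction m with
      | zero => simp [C0]
      | succ m ih =>
        rw [Cs]
        simp only
        rw [Finset.sum_add_distrib, ih, Finset.sum_ite_eq, if_pos (by simpa using (hpick m ih).1)]
    exact ⟨hsum, hpick m hsum⟩
  have hupper : ∀ m i : ℕ, i < k → (C m i : ℝ) ≤ a i * m + 1 := by
    intro m i hi
    induction m with
    | zero => simp [C0]
    | succ m ih =>
      rw [Cs]; push_cast
      split_ifs with h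
      · have := (main m).2.2
        rw [show v m = i from h] at this
        push_cast; linarith
      · have := ha i hi
        push_cast; nlinarith
  have hlower : ∀ m i : ℕ, i < k → a i * m - k ≤ (C m i : ℝ) := by
    intro m i hi
    have h1 : ∑ j ∈ Finset.range k, (a j * m - (C m j : ℝ)) = 0 := by
      rw [Finset.sum_sub_distrib, ← Finset.sum_mul, hs, ← Nat.cast_sum, (main m).1]; ring
    rw [← Finset.add_sum_erase _ _ (Finset.mem_range.2 hi)] at h1
    have h2 : ∑ j ∈ (Finset.range k).erase i, (-1 : ℝ) ≤ ∑ j ∈ (Finset.range k).erase i, (a j * m - (C m j : ℝ)) :=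
      Finset.sum_le_sum fun j hj => by
        have := hupper m j (by simpa using (Finset.mem_erase.1 hj).2)
        linarith
    rw [Finset.sum_const, Finset.card_erase_of_mem (Finset.mem_range.2 hi), Finset.card_range] at h2
    have h3 : ((k - 1 : ℕ) : ℝ) ≤ k := by exact_mod_cast Nat.sub_le k 1
    rw [nsmul_eq_mul] at h2
    linarith
  refine ⟨v, fun r => (main r).2.1, fun r h0 => ?_, fun i hi => ?_⟩
  · have := (main r).2.2
    rw [h0] at this
    have : (0:ℝ) ≤ C r (v r) := Nat.cast_nonneg _
    linarith
  · simp only [hcnt]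
    have z1 : Tendsto (fun m : ℕ => a i - (k : ℝ) / (m : ℝ)) atTop (𝓝 (a i)) := by
      have := tendsto_const_nhds (x := a i) |>.sub (tendsto_const_div_atTop_nhds_zero_nat (k : ℝ))
      simpa using this
    have z2 : Tendsto (fun m : ℕ => a i + (1 : ℝ) / (m : ℝ)) atTop (𝓝 (a i)) := by
      have := tendsto_const_nhds (x := a i) |>.add (tendsto_const_div_atTop_nhds_zero_nat (1 : ℝ))
      simpa using this
    refine tendsto_of_tendsto_of_tendsto_of_le_of_le' z1 z2 ?_ ?_
    · filter_upwards [eventually_gt_atTop 0] with m hm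
      have hm' : (0 : ℝ) < m := by exact_mod_cast hm
      rw [le_div_iff₀ hm', sub_mul, div_mul_cancel₀ _ hm'.ne']
      exact hlower m i hi
    · filter_upwards [eventually_gt_atTop 0] with m hm
      have hm' : (0 : ℝ) < m := by exact_mod_cast hm
      rw [div_le_iff₀ hm', add_mul, div_mul_cancel₀ _ hm'.ne']
      exact hupper m i hi

theorem sq_count (r : ℕ) : ((Finset.range r).filter fun s => IsSquare s).card ≤ Nat.sqrt r + 1 := by
  calc _ ≤ ((Finset.range (Nat.sqrt r + 1)).image fun x => x * x).card := by
        apply Finset.card_le_card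
        intro s hs
        obtain ⟨h1, y, rfl⟩ := Finset.mem_filter.1 hs
        rw [Finset.mem_range] at h1
        refine Finset.mem_image.2 ⟨y, Finset.mem_range.2 ?_, rfl⟩
        have := Nat.le_sqrt.2 h1.le
        omega
    _ ≤ _ := Finset.card_image_le.trans (by simp)

theorem sq_zero {v : Seq} {i : ℕ} (r : ℕ) :
    |(digitCount (fun m => if IsSquare m then 0 else v m) i r : ℝ) - digitCount v i r| ≤ (Nat.sqrt r : ℝ) + 1 := by
  set S := (Finset.range r).filter fun s => IsSquare s with hS
  have h1 : digitCount (fun m => if IsSquare m then 0 else v m) i r ≤ digitCount v i r + S.card := by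
    unfold digitCount
    refine le_trans (Finset.card_le_card ?_) (Finset.card_union_le _ _)
    intro s hs
    simp only [hS, Finset.mem_filter, Finset.mem_union, Finset.mem_range] at hs ⊢
    by_cases h : IsSquare s
    · exact Or.inr ⟨hs.1, h⟩
    · rw [if_neg h] at hs; exact Or.inl hs
  have h2 : digitCount v i r ≤ digitCount (fun m => if IsSquare m then 0 else v m) i r + S.card := by
    unfold digitCount
    refine le_trans (Finset.card_le_card ?_) (Finset.card_union_le _ _)
    intro s hs
    simp only [hS, Finset.mem_filter, Finset.mem_union, Finset.mem_range] at hs ⊢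
    by_cases h : IsSquare s
    · exact Or.inr ⟨hs.1, h⟩
    · rw [if_neg h]; exact Or.inl hs
  have h3 := sq_count r
  rw [← hS] at h3
  have h1' : (digitCount (fun m => if IsSquare m then 0 else v m) i r : ℝ) ≤ digitCount v i r + S.card := by exact_mod_cast h1
  have h2' : (digitCount v i r : ℝ) ≤ digitCount (fun m => if IsSquare m then 0 else v m) i r + S.card := by exact_mod_cast h2
  have h3' : (S.card : ℝ) ≤ Nat.sqrt r + 1 := by exact_mod_cast h3
  rw [abs_le]; constructor <;> linarith

theorem sqrt_div : Tendsto (fun r : ℕ => ((Nat.sqrt r : ℝ) + 1) / (r : ℝ)) atTop (𝓝 0) := by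
  have h1 : Tendsto (fun r : ℕ => (Real.sqrt (r : ℝ))⁻¹ + 1 / (r : ℝ)) atTop (𝓝 (0 + 0)) := by
    refine Tendsto.add ?_ tendsto_one_div_atTop_nhds_zero_nat
    exact tendsto_inv_atTop_zero.comp (Real.tendsto_sqrt_atTop.comp tendsto_natCast_atTop_atTop)
  rw [add_zero] at h1
  refine squeeze_zero' (Eventually.of_forall fun r => by positivity) ?_ h1
  filter_upwards [eventually_gt_atTop 0] with r hr
  have hr' : (0 : ℝ) < r := by exact_mod_cast hr
  rw [add_div]
  gcongr
  rw [div_le_iff₀ hr', ← div_eq_inv_mul, Real.div_sqrt]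
  exact Real.nat_sqrt_le_real_sqrt

theorem lower_base {k : ℕ} (hk : 3 ≤ k) {a : ℕ → ℝ} (ha : InCone k [] a) (hs : ∑ i ∈ Finset.range k, a i = 1) :
    ∃ v : Seq, InSigma k v ∧ (∀ r, seqLt (shift^[r] v) (constSeq (k - 2))) ∧ HF k v a := by
  obtain ⟨v, hv, hz, hf⟩ := greedy_exists ha.1 hs
  have hv2 : ∀ r, v r ≤ k - 2 := by
    intro r
    have := hv r
    have h3 : v r ≠ k - 1 := fun h => hz r (by rw [h]; exact ha.2)
    omega
  set w : Seq := fun m => if IsSquare m then 0 else v m with hw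
  have hw2 : ∀ r, w r ≤ k - 2 := by
    intro r; show (if IsSquare r then 0 else v r) ≤ _
    split_ifs
    · omega
    · exact hv2 r
  refine ⟨w, fun r => by have := hw2 r; omega, fun r => ?_, fun i hi => ?_⟩
  · have hex : ∃ m, (shift^[r] w) m ≠ k - 2 := by
      refine ⟨(r + 1) * (r + 1) - r, ?_⟩
      rw [shift_iter_apply, Nat.sub_add_cancel (by nlinarith)]
      have : w ((r + 1) * (r + 1)) = 0 := if_pos ⟨r + 1, rfl⟩
      rw [this]; omega
    have hsp := Nat.find_spec hex
    have hmn := fun m => Nat.find_min hex (m := m)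
    refine ⟨Nat.find hex, fun s hs => by simpa [constSeq] using hmn s hs, ?_⟩
    have := hw2 (Nat.find hex + r)
    rw [← shift_iter_apply r w] at this
    show _ < k - 2
    omega
  · have hd : Tendsto (fun r : ℕ => (digitCount w i r : ℝ) / r - (digitCount v i r : ℝ) / r) atTop (𝓝 0) := by
      refine squeeze_zero_norm (fun r => ?_) sqrt_div
      rw [← sub_div, norm_div, Real.norm_eq_abs, Real.norm_natCast]
      have := sq_zero (v := v) (i := i) r
      gcongr
    have := hd.add (hf i hi)
    simpa using this

/-! ### Realizing frequencies: inductive step -/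

theorem app_seqLt (l : List ℕ) {x y : Seq} (h : seqLt x y) : seqLt (app l x) (app l y) := by
  obtain ⟨r, h1, h2⟩ := h
  refine ⟨l.length + r, fun s hs => ?_, by rw [app_ge, app_ge]; exact h2⟩
  by_cases h : s < l.length
  · rw [app_lt _ _ h, app_lt _ _ h]
  · push Not at h
    rw [app_ge' _ _ h, app_ge' _ _ h]; exact h1 _ (by omega)

/-- the block of the digit `d` with `b` extra zeros -/
def blk (k n d b : ℕ) : List ℕ := lamWord k n d ++ List.replicate b 0

theorem blk_ne_nil (k n d b : ℕ) : blk k n d b ≠ [] := by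
  simp [blk, lamWord_ne_nil]

theorem blk_lt {k : ℕ} (hk : 3 ≤ k) (n d b x : ℕ) (hx : x ∈ blk k n d b) : x < k := by
  unfold blk lamWord at hx
  split_ifs at hx <;> simp at hx <;> omega

theorem blk_tail (k n d b j : ℕ) (hj : j < (blk k n d b).length) (h0 : 0 < j) : (blk k n d b)[j] = 0 := by
  have h : ∃ c m, blk k n d b = c :: List.replicate m 0 := by
    unfold blk lamWord
    split_ifs
    · exact ⟨_, b, rfl⟩
    · exact ⟨k - 1, n + 1 + b, by simp⟩
    · exact ⟨k - 1, n + b, by simp⟩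
  obtain ⟨c, m, h⟩ := h
  obtain ⟨j, rfl⟩ := Nat.exists_eq_succ_of_ne_zero h0.ne'
  simp [h]

theorem blk_count {k : ℕ} (hk : 3 ≤ k) (n d b i : ℕ) (hd : d < k) (hi : i < k) :
    (blk k n d b).count i = (if i = 0 then b else 0) + MnN k n (fun e => if d = e then 1 else 0) i := by
  unfold blk MnN lamWord
  rw [List.count_append, List.count_replicate]
  rcases (show d + 2 < k ∨ d + 2 = k ∨ d + 1 = k by omega) with h | h | h
  · rw [if_pos h]
    rw [List.count_singleton]
    simp only [beq_iff_eq]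
    split_ifs <;> simp <;> omega
  · rw [if_neg (by omega), if_pos h, List.count_cons, List.count_replicate]
    simp only [beq_iff_eq]
    split_ifs <;> simp <;> omega
  · rw [if_neg (by omega), if_neg (by omega), List.count_cons, List.count_replicate]
    simp only [beq_iff_eq]
    split_ifs <;> simp <;> omega

theorem MnN_add (k n : ℕ) (a b : ℕ → ℕ) (i : ℕ) :
    MnN k n (fun e => a e + b e) i = MnN k n a i + MnN k n b i := by
  unfold MnN; split_ifs <;> ring

theorem blk_sum {k : ℕ} (hk : 3 ≤ k) (n : ℕ) {v : Seq} (hv : InSigma k v) (b : ℕ → ℕ) (hb : Monotone b) (hb0 : b 0 = 0)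
    {i : ℕ} (hi : i < k) (q : ℕ) :
    ∑ j ∈ Finset.range q, (blk k n (v j) (b (j + 1) - b j)).count i =
      (if i = 0 then b q else 0) + MnN k n (fun e => digitCount v e q) i := by
  induction q with
  | zero => simp [digitCount_zero, hb0, MnN]
  | succ q ih =>
    rw [Finset.sum_range_succ, ih, blk_count hk n _ _ _ (hv q) hi]
    simp only [digitCount_succ]
    rw [MnN_add]
    have := hb (Nat.le_succ q)
    simp only [Nat.succ_eq_add_one] at this
    split_ifs <;> omega

theorem floor_div {c : ℝ} (hc : 0 ≤ c) :
    Tendsto (fun q : ℕ => ((⌊c * q⌋₊ : ℕ) : ℝ) / (q : ℝ)) atTop (𝓝 c) := by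
  exact (tendsto_nat_floor_mul_div_atTop hc).comp tendsto_natCast_atTop_atTop

theorem lower_step {k : ℕ} (hk : 3 ≤ k) (n : ℕ) {v : Seq} (hv : InSigma k v) {a' : ℕ → ℝ} (hf : HF k v a')
    {c : ℝ} (hc : 0 ≤ c) {a : ℕ → ℝ} {S : ℝ} (hS : 0 < S)
    (ha : ∀ i < k, a i / S = (if i = 0 then c else 0) + Mn k n a' i) (hs : ∑ i ∈ Finset.range k, a i = 1)
    {T : Seq} (hT : InSigma k T) (hlt : ∀ r, seqLt (shift^[r] v) T) :
    ∃ u, InSigma k u ∧ (∀ r, seqLt (shift^[r] u) (lamSub k n T)) ∧ HF k u a := by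
  set b : ℕ → ℕ := fun q => ⌊c * q⌋₊ with hb
  have hbm : Monotone b := by
    intro x y hxy
    apply Nat.floor_le_floor
    have : (x : ℝ) ≤ y := by exact_mod_cast hxy
    gcongr
  have hb0 : b 0 = 0 := by simp [hb]
  set B : ℕ → List ℕ := fun j => blk k n (v j) (b (j + 1) - b j) with hBdef
  have hB : ∀ j, B j ≠ [] := fun j => blk_ne_nil _ _ _ _
  have hsig : InSigma k (cat B) := by
    intro m
    obtain ⟨q, j, hj, rfl⟩ := exists_pos hB m
    rw [cat_pos hB q j hj]
    exact blk_lt hk _ _ _ _ (List.getElem_mem hj)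
  refine ⟨cat B, hsig, fun r => ?_, ?_⟩
  · obtain ⟨q, j, hj, rfl⟩ := exists_pos hB r
    rcases Nat.eq_zero_or_pos j with rfl | hj0
    · rw [Nat.add_zero, cat_shift hB]
      refine seqLt_of_le_of_lt (v := lamSub k n (shift^[q] v)) ?_ (lam_strictMono hk n hT (hlt q))
      refine seqLe_coind (fun x y => ∃ q, x = cat (fun i => B (i + q)) ∧ y = lamSub k n (shift^[q] v)) ?_ ⟨q, rfl, rfl⟩
      rintro x y ⟨q, rfl, rfl⟩
      have e1 : cat (fun i => B (i + q)) = app (lamWord k n (v q)) (app (List.replicate (b (q + 1) - b q) 0) (cat fun i => B (i + (q + 1)))) := by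
        rw [cat_cons (fun _ => hB _), ← app_append]
        simp only [Nat.zero_add, Nat.add_assoc, Nat.add_comm 1 q]
        rfl
      have e2 : lamSub k n (shift^[q] v) = app (lamWord k n (v q)) (lamSub k n (shift^[q + 1] v)) := by
        rw [lam_cons, shift_iter_apply, Nat.zero_add, Function.iterate_succ_apply']
      rcases Nat.eq_zero_or_pos (b (q + 1) - b q) with h0 | h0
      · right
        refine ⟨_, lamWord_ne_nil k n (v q), _, _, e1, e2, q + 1, ?_, rfl⟩
        rw [h0]; rfl
      · left
        rw [e1, e2]
        apply app_seqLt
        apply seqLe_of_head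
        rw [app_lt _ _ (by simpa using h0), lam_zero]
        simp only [List.getElem_replicate]
        split_ifs <;> omega
    · apply seqLe_of_head
      rw [shift_iter_apply, Nat.zero_add, cat_pos hB q j hj, lam_zero]
      have := blk_tail _ _ _ _ j hj hj0
      rw [this]
      split_ifs <;> omega
  · have h2 : ∀ i < k, Tendsto (fun q : ℕ => (digitCount (cat B) i (pos B q) : ℝ) / (q : ℝ)) atTop (𝓝 (a i / S)) := by
      intro i hi
      simp only [digitCount_cat hB]
      simp only [hBdef, blk_sum hk n hv b hbm hb0 hi]
      rw [ha i hi]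
      have f0 := hf (k - 2) (by omega)
      have f1 := hf (k - 1) (by omega)
      have f2 := hf (i - 1) (by omega)
      have fb := floor_div hc
      have hM : Tendsto (fun q : ℕ => (MnN k n (fun e => digitCount v e q) i : ℝ) / (q : ℝ)) atTop (𝓝 (Mn k n a' i)) := by
        unfold MnN Mn
        split_ifs
        · have := (f0.const_mul ((n : ℝ) + 1)).add (f1.const_mul (n : ℝ))
          refine this.congr fun q => ?_
          push_cast; ring
        · refine (f0.add f1).congr fun q => ?_
          push_cast; ring
        · exact f2
      have hb' : Tendsto (fun q : ℕ => ((if i = 0 then b q else 0 : ℕ) : ℝ) / (q : ℝ)) atTop (𝓝 (if i = 0 then c else 0)) := by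
        split_ifs
        · exact fb
        · simp
      refine (hb'.add hM).congr fun q => ?_
      push_cast; ring
    have h1 : Tendsto (fun q : ℕ => (pos B q : ℝ) / (q : ℝ)) atTop (𝓝 (1 / S)) := by
      have := tendsto_finsetSum (Finset.range k) fun i hi => h2 i (Finset.mem_range.1 hi)
      rw [← Finset.sum_div, hs] at this
      refine this.congr fun q => ?_
      rw [← Finset.sum_div, ← Nat.cast_sum, digitCount_total hsig]
    intro i hi
    have := freq_sample (D := digitCount (cat B) i) (fun x y h => digitCount_mono _ _ h) (p := pos B)
      (monotone_nat_of_le_succ fun q => by rw [pos_succ]; omega) (pos_zero B)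
      (tendsto_atTop_mono (le_pos hB) tendsto_id) (one_div_pos.2 hS) h1 (h2 i hi)
    rwa [div_div_div_cancel_right₀ hS.ne', div_one] at this

theorem lower {k : ℕ} (hk : 3 ≤ k) (l : List ℕ) : ∀ {a : ℕ → ℝ}, InCone k l a → ∑ i ∈ Finset.range k, a i = 1 →
    ∃ v : Seq, InSigma k v ∧ (∀ r, seqLt (shift^[r] v) (lamList k l (constSeq (k - 2)))) ∧ HF k v a := by
  induction l with
  | nil => intro a ha hs; exact lower_base hk ha hs
  | cons n t ih =>
    rintro a ⟨c, a', hc, ha', ha⟩ hs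
    have hn : ∀ i < k, 0 ≤ a' i := fun i hi => inCone_nonneg hk ha' hi
    set S := ∑ i ∈ Finset.range k, a' i with hSdef
    have hS0 : 0 ≤ S := Finset.sum_nonneg fun i hi => hn i (Finset.mem_range.1 hi)
    have hT : InSigma k (lamList k t (constSeq (k - 2))) :=
      lamList_insigma hk t fun r => by unfold constSeq; omega
    rcases hS0.eq_or_lt with h0 | h0
    · have hz : ∀ i < k, a' i = 0 := fun i hi =>
        (Finset.sum_eq_zero_iff_of_nonneg fun i hi => hn i (Finset.mem_range.1 hi)).1 h0.symm i (Finset.mem_range.2 hi)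
      have ha2 : ∀ i < k, a i = if i = 0 then c else 0 := by
        intro i hi
        rw [ha i hi]
        have : Mn k n a' i = 0 := by
          unfold Mn
          rw [hz _ (by omega), hz _ (by omega), hz _ (by omega)]; simp
        rw [this, add_zero]
      have hc1 : c = 1 := by
        rw [Finset.sum_congr rfl fun i hi => ha2 i (Finset.mem_range.1 hi), Finset.sum_ite_eq',
          if_pos (Finset.mem_range.2 (by omega))] at hs
        exact hs
      refine ⟨constSeq 0, fun r => by unfold constSeq; omega, fun r => seqLe_of_head ?_, fun i hi => ?_⟩
      · rw [shift_iter_apply]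
        show 0 < lamSub k n _ 0
        rw [lam_zero]; split_ifs <;> omega
      · rw [ha2 i hi, hc1]
        have hd : ∀ r, digitCount (constSeq 0) i r = if i = 0 then r else 0 := by
          intro r
          unfold digitCount constSeq
          split_ifs with h
          · subst h; simp
          · rw [Finset.filter_false_of_mem fun _ _ => Ne.symm h]; rfl
        simp only [hd]
        split_ifs
        · refine tendsto_const_nhds.congr' ?_
          filter_upwards [eventually_gt_atTop 0] with r hr
          have : (r : ℝ) ≠ 0 := by positivity
          rw [div_self this]
        · simp
    · obtain ⟨v, hv, hlt, hf⟩ := ih (a := fun i => S⁻¹ * a' i)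
        (inCone_smul hk ha' (inv_nonneg.2 hS0) fun i _ => rfl)
        (by rw [← Finset.mul_sum, ← hSdef, inv_mul_cancel₀ h0.ne'])
      refine lower_step hk n hv hf (c := c / S) (by positivity) h0 (fun i hi => ?_) hs hT hlt
      rw [ha i hi]
      unfold Mn
      split_ifs <;> field_simp <;> simp

/-! ### Bounding frequencies -/

theorem HF_nonneg {k : ℕ} {v : Seq} {a : ℕ → ℝ} (h : HF k v a) {i : ℕ} (hi : i < k) : 0 ≤ a i :=
  ge_of_tendsto' (h i hi) fun r => by positivity

theorem HF_sum {k : ℕ} {v : Seq} (hv : InSigma k v) {a : ℕ → ℝ} (h : HF k v a) :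
    ∑ i ∈ Finset.range k, a i = 1 := by
  have := tendsto_finsetSum (Finset.range k) fun i hi => h i (Finset.mem_range.1 hi)
  refine tendsto_nhds_unique this ?_
  refine tendsto_const_nhds.congr' ?_
  filter_upwards [eventually_gt_atTop 0] with r hr
  have : (r : ℝ) ≠ 0 := by positivity
  rw [← Finset.sum_div, ← Nat.cast_sum, digitCount_total hv, div_self this]

theorem upper_base {k : ℕ} (hk : 3 ≤ k) {v : Seq}
    (hX : ∀ r, seqLe (shift^[r] v) (baseSeq k)) {a : ℕ → ℝ} (hf : HF k v a) : InCone k [] a := by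
  refine ⟨fun i hi => HF_nonneg hf hi, ?_⟩
  have hz : ∀ r, v r = k - 1 → ∀ s, r < s → v s = 0 := by
    intro r hr s hs
    obtain ⟨j, rfl⟩ := Nat.exists_eq_add_of_lt hs
    rcases hX r with ⟨g, h1, h2⟩ | h
    · rcases Nat.eq_zero_or_pos g with rfl | hg
      · simp [shift_iter_apply, baseSeq, hr] at h2
      · unfold baseSeq at h2; rw [if_neg hg.ne'] at h2; omega
    · have := congrFun h (j + 1)
      rw [shift_iter_apply] at this
      rw [show r + j + 1 = j + 1 + r by ring, this]; simp [baseSeq]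
  have hc : ∀ r, digitCount v (k - 1) r ≤ 1 := by
    intro r
    unfold digitCount
    rw [Finset.card_le_one]
    intro x hx y hy
    simp only [Finset.mem_filter] at hx hy
    rcases lt_trichotomy x y with h | h | h
    · have := hz x hx.2 y h; omega
    · exact h
    · have := hz y hy.2 x h; omega
  refine tendsto_nhds_unique (hf (k - 1) (by omega)) ?_
  refine squeeze_zero (fun r => by positivity) (fun r => ?_) tendsto_one_div_atTop_nhds_zero_nat
  have : (digitCount v (k - 1) r : ℝ) ≤ 1 := by exact_mod_cast hc r
  gcongr

theorem zeros_after {x y : Seq} {n : ℕ} (h : seqLe x y) (h0 : x 0 = y 0) (hy : ∀ j, 1 ≤ j → j ≤ n → y j = 0) :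
    ∀ j, 1 ≤ j → j ≤ n → x j = 0 := by
  intro j hj hjn
  rcases h with ⟨g, h1, h2⟩ | rfl
  · by_cases hg : j < g
    · rw [h1 j hg]; exact hy j hj hjn
    · rcases Nat.eq_zero_or_pos g with rfl | hg0
      · omega
      · have := hy g hg0 (by omega)
        omega
  · exact hy j hj hjn

/-- height function -/
def ht (k n : ℕ) (v : Seq) (r : ℕ) : ℤ := ((n : ℤ) + 1) * (digitCount v (k - 1) r : ℤ) - (digitCount v 0 r : ℤ)

theorem ht_succ (k n : ℕ) (v : Seq) (r : ℕ) :
    ht k n v (r + 1) = ht k n v r + (if v r = k - 1 then (n : ℤ) + 1 else 0) - (if v r = 0 then 1 else 0) := by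
  unfold ht
  rw [digitCount_succ, digitCount_succ]
  split_ifs <;> push_cast <;> ring

theorem ht_hi {k : ℕ} (hk : 3 ≤ k) {n : ℕ} {v : Seq} {r : ℕ} (h : v r = k - 1) : ht k n v (r + 1) = ht k n v r + n + 1 := by
  rw [ht_succ, if_pos h, if_neg (by omega)]; ring

theorem ht_zero {k : ℕ} (hk : 3 ≤ k) {n : ℕ} {v : Seq} {r : ℕ} (h : v r = 0) : ht k n v (r + 1) = ht k n v r - 1 := by
  rw [ht_succ, if_neg (by omega), if_pos h]; ring

theorem ht_mid {k n : ℕ} {v : Seq} {r : ℕ} (h0 : v r ≠ 0) (h : v r ≠ k - 1) : ht k n v (r + 1) = ht k n v r := by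
  rw [ht_succ, if_neg h, if_neg h0]; ring

theorem ht_run {k : ℕ} (hk : 3 ≤ k) {n : ℕ} {v : Seq} {r : ℕ} (h : v r = k - 1) (m : ℕ)
    (hz : ∀ j, 1 ≤ j → j ≤ m → v (r + j) = 0) : ht k n v (r + m + 1) = ht k n v r + n + 1 - m := by
  induction m with
  | zero => rw [Nat.add_zero, ht_hi hk h]; simp
  | succ m ih =>
    have := ih fun j h1 h2 => hz j h1 (by omega)
    rw [ht_zero hk (show v (r + (m + 1)) = 0 from hz _ (by omega) le_rfl), ← Nat.add_assoc, this]
    push_cast; ring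

/-- clean positions -/
def clean (k n : ℕ) (v : Seq) (P : ℕ) : Prop := ∀ s, P ≤ s → ht k n v P ≤ ht k n v s

/-- unmatched positions -/
def unm (k n : ℕ) (v : Seq) (P : ℕ) : Prop := ∀ s, P < s → ht k n v P < ht k n v s

theorem unm_clean {k n : ℕ} {v : Seq} {P : ℕ} (h : unm k n v P) : clean k n v P := by
  intro s hs
  rcases hs.eq_or_lt with rfl | hs
  · exact le_rfl
  · exact (h s hs).le

theorem clean_ne {k : ℕ} (hk : 3 ≤ k) {n : ℕ} {v : Seq} {P : ℕ} (h : clean k n v P) : v P ≠ 0 := by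
  intro h0
  have := h (P + 1) (by omega)
  rw [ht_zero hk h0] at this
  omega

/-- image digit -/
noncomputable def phd (k n : ℕ) (v : Seq) (P : ℕ) : ℕ :=
  if v P = k - 1 then (if unm k n v P then k - 1 else k - 2) else v P - 1

/-- desubstituted sequence -/
noncomputable def des (k n : ℕ) (v : Seq) : Seq := fun j => phd k n v (Nat.nth (fun r => v r ≠ 0) j)

theorem des_count {k n : ℕ} {v : Seq} {P : ℕ} (h : v P ≠ 0) :
    des k n v (Nat.count (fun r => v r ≠ 0) P) = phd k n v P := by
  unfold des
  rw [Nat.nth_count (p := fun r => v r ≠ 0) h]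

theorem des_insigma {k : ℕ} (hk : 3 ≤ k) {n : ℕ} {v : Seq} (hv : InSigma k v) : InSigma k (des k n v) := by
  intro j
  show phd k n v _ < k
  unfold phd
  have := hv (Nat.nth (fun r => v r ≠ 0) j)
  split_ifs <;> omega

theorem des_digit {k : ℕ} {n : ℕ} {v : Seq} (e r : ℕ) :
    digitCount (des k n v) e (Nat.count (fun r => v r ≠ 0) r) =
      ((Finset.range r).filter fun s => v s ≠ 0 ∧ phd k n v s = e).card := by
  induction r with
  | zero => simp [digitCount_zero]
  | succ r ih =>
    rw [Finset.range_add_one, Finset.filter_insert, Nat.count_succ]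
    by_cases h : v r = 0
    · rw [if_neg (by simpa using h), if_neg (by simp [h]), Nat.add_zero, ih]
    · rw [if_pos h, digitCount_succ, ih, des_count h]
      by_cases h2 : phd k n v r = e
      · rw [if_pos h2, if_pos ⟨h, h2⟩, Finset.card_insert_of_notMem (by simp)]
      · rw [if_neg h2, if_neg (by tauto), Nat.add_zero]

/-- the height is controlled by the number of unmatched positions -/
theorem unm_count {k : ℕ} (hk : 3 ≤ k) {n : ℕ} {v : Seq}
    (hz : ∀ r, v r = k - 1 → ∀ j, 1 ≤ j → j ≤ n → v (r + j) = 0)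
    (hbd : ∃ b, ∀ r, b ≤ ht k n v r) (U : ℕ → ℕ)
    (hU : ∀ r, U r = ((Finset.range r).filter fun s => v s = k - 1 ∧ unm k n v s).card) :
    ∃ C : ℤ, ∀ r, (∀ s, r ≤ s → U r + C ≤ ht k n v s) ∧ ∃ s, r ≤ s ∧ ht k n v s = U r + C := by
  obtain ⟨b, hb⟩ := hbd
  obtain ⟨C, ⟨s0, hs0⟩, hC⟩ := Int.exists_least_of_bdd (P := fun z => ∃ r, ht k n v r = z)
    ⟨b, by rintro z ⟨r, rfl⟩; exact hb r⟩ ⟨_, 0, rfl⟩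
  have hU0 : U 0 = 0 := by simp [hU]
  have hUs : ∀ r, U (r + 1) = U r + if v r = k - 1 ∧ unm k n v r then 1 else 0 := by
    intro r
    rw [hU, hU, Finset.range_add_one, Finset.filter_insert]
    split_ifs
    · rw [Finset.card_insert_of_notMem (by simp)]
    · simp
  refine ⟨C, fun r => ?_⟩
  induction r with
  | zero =>
    refine ⟨fun s _ => ?_, s0, by omega, ?_⟩
    · rw [hU0]; simpa using hC _ ⟨s, rfl⟩
    · rw [hU0]; simpa using hs0
  | succ r ih =>
    obtain ⟨h1, s, hs, hse⟩ := ih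
    rw [hUs]
    split_ifs with h
    · have hsr : s = r := by
        by_contra hne
        have := h.2 s (by omega)
        have := h1 r le_rfl
        omega
      subst hsr
      refine ⟨fun s' hs' => ?_, s + n + 1, by omega, ?_⟩
      · have := h.2 s' (by omega)
        push_cast; omega
      · rw [ht_run hk h.1 n (hz s h.1), hse]; push_cast; ring
    · refine ⟨fun s' hs' => by simpa using h1 s' (by omega), ?_⟩
      simp only [Nat.add_zero]
      rcases hs.eq_or_lt with rfl | hlt
      · by_cases hv0 : v r = 0
        · have := h1 (r + 1) (by omega)
          rw [ht_zero hk hv0] at this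
          omega
        · by_cases hv1 : v r = k - 1
          · have hnu : ¬ unm k n v r := fun hu => h ⟨hv1, hu⟩
            unfold unm at hnu
            push Not at hnu
            obtain ⟨s', hs', hle⟩ := hnu
            have := h1 s' hs'.le
            exact ⟨s', hs', by omega⟩
          · exact ⟨r + 1, le_rfl, by rw [ht_mid hv0 hv1, hse]⟩
      · exact ⟨s, hlt, hse⟩

/-- comparison at clean positions -/
theorem des_le {k : ℕ} (hk : 3 ≤ k) {n : ℕ} {v : Seq} (hv : InSigma k v)
    (hz : ∀ r, v r = k - 1 → ∀ j, 1 ≤ j → j ≤ n → v (r + j) = 0) {P : ℕ} (hP : clean k n v P) :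
    seqLe (lamSub k n (shift^[Nat.count (fun r => v r ≠ 0) P] (des k n v))) (shift^[P] v) := by
  set cnt := Nat.count (fun r => v r ≠ 0) with hcnt
  refine seqLe_coind (fun x y => ∃ P, clean k n v P ∧ x = lamSub k n (shift^[cnt P] (des k n v)) ∧ y = shift^[P] v)
    ?_ ⟨P, hP, rfl, rfl⟩
  rintro x y ⟨P, hP, rfl, rfl⟩
  have hP0 := clean_ne hk hP
  have hkP := hv P
  have e1 : lamSub k n (shift^[cnt P] (des k n v)) =
      app (lamWord k n (phd k n v P)) (lamSub k n (shift^[cnt P + 1] (des k n v))) := by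
    rw [lam_cons, shift_iter_apply, Nat.zero_add, hcnt, des_count hP0, Function.iterate_succ_apply']
  have cP : cnt (P + 1) = cnt P + 1 := by rw [hcnt, Nat.count_succ, if_pos hP0]
  -- a prefix of `v` at `P`
  have pre : ∀ m, (∀ j, 1 ≤ j → j ≤ m → v (P + j) = 0) → 
      shift^[P] v = app (v P :: List.replicate m 0) (shift^[P + m + 1] v) ∧ cnt (P + m + 1) = cnt P + 1 := by
    intro m hm
    constructor
    · funext i
      by_cases hi : i < (v P :: List.replicate m 0).length
      · rw [app_lt _ _ hi, shift_iter_apply]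
        rcases i with _ | i
        · simp
        · simp only [List.getElem_cons_succ, List.getElem_replicate]
          rw [Nat.add_comm]; exact hm _ (by omega) (by simp at hi; omega)
      · push Not at hi
        rw [app_ge' _ _ hi, shift_iter_apply, shift_iter_apply]
        simp at hi ⊢
        congr 1; omega
    · induction m with
      | zero => exact cP
      | succ m ih =>
        have := ih fun j h1 h2 => hm j h1 (by omega)
        rw [hcnt, Nat.count_succ, if_neg (by simpa using hm (m + 1) (by omega) le_rfl)]
        exact this
  by_cases h1 : v P = k - 1
  · have hzP := hz P h1
    by_cases hu : unm k n v P
    · have hph : phd k n v P = k - 1 := by unfold phd; rw [if_pos h1, if_pos hu]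
      rw [hph, lamWord_hi (by omega)] at e1
      obtain ⟨p1, p2⟩ := pre n hzP
      rw [h1] at p1
      refine Or.inr ⟨_, by simp, _, _, e1, p1, P + n + 1, fun s hs => ?_, by rw [p2], rfl⟩
      rw [ht_run hk h1 n hzP]
      have := hu s (by omega)
      omega
    · have hph : phd k n v P = k - 2 := by unfold phd; rw [if_pos h1, if_neg hu]
      rw [hph, lamWord_mid (by omega)] at e1
      by_cases h0 : v (P + n + 1) = 0
      · have hz' : ∀ j, 1 ≤ j → j ≤ n + 1 → v (P + j) = 0 := by
          intro j hj hj'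
          rcases Nat.lt_or_ge n j with h | h
          · rw [show j = n + 1 by omega]; exact h0
          · exact hzP j hj h
        obtain ⟨p1, p2⟩ := pre (n + 1) hz'
        rw [h1] at p1
        refine Or.inr ⟨_, by simp, _, _, e1, p1, P + (n + 1) + 1, fun s hs => ?_, by rw [p2], rfl⟩
        rw [ht_run hk h1 (n + 1) hz']
        have := hP s (by omega)
        push_cast; omega
      · obtain ⟨p1, p2⟩ := pre n hzP
        rw [h1] at p1
        left
        rw [e1, p1, List.replicate_succ', ← List.cons_append, app_append]
        apply app_seqLt
        apply seqLe_of_head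
        rw [app_lt _ _ (by simp), shift_iter_apply, Nat.zero_add]
        simp only [List.getElem_cons_zero]
        omega
  · have hph : phd k n v P = v P - 1 := by unfold phd; rw [if_neg h1]
    rw [hph, lamWord_lo (by omega), Nat.sub_add_cancel (by omega)] at e1
    obtain ⟨p1, p2⟩ := pre 0 (fun j h1 h2 => by omega)
    refine Or.inr ⟨_, by simp, _, _, e1, p1, P + 0 + 1, fun s hs => ?_, by rw [p2], rfl⟩
    rw [Nat.add_zero, ht_mid hP0 h1]
    exact hP s (by omega)

theorem upper_step {k : ℕ} (hk : 3 ≤ k) {n : ℕ} {v s' : Seq} (hv : InSigma k v) (hs' : s' 0 = k - 1)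
    (hX : ∀ r, seqLe (shift^[r] v) (lamSub k n s')) {a : ℕ → ℝ} (hf : HF k v a)
    (hd : a 0 < ((n : ℝ) + 1) * a (k - 1)) :
    ∃ v' a', InSigma k v' ∧ (∀ r, seqLe (shift^[r] v') s') ∧ HF k v' a' ∧ 0 < 1 - a 0 ∧
      ∀ i < k, a i = (1 - a 0) * Mn k n a' i := by
  set δ : ℝ := ((n : ℝ) + 1) * a (k - 1) - a 0 with hδ
  have hδ0 : 0 < δ := by rw [hδ]; linarith
  have hz : ∀ r, v r = k - 1 → ∀ j, 1 ≤ j → j ≤ n → v (r + j) = 0 := by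
    intro r hr j hj hjn
    have := zeros_after (n := n) (hX r) (by rw [shift_iter_apply, Nat.zero_add, hr, lam_head_good hk hs'])
      (fun j h1 h2 => by
        rw [lam_cons, hs', lamWord_hi (by omega), app_lt _ _ (by simp; omega)]
        obtain ⟨j, rfl⟩ := Nat.exists_eq_succ_of_ne_zero (show j ≠ 0 by omega)
        simp) j hj hjn
    rwa [shift_iter_apply, Nat.add_comm] at this
  have hht : Tendsto (fun r : ℕ => (ht k n v r : ℝ) / (r : ℝ)) atTop (𝓝 δ) := by
    have := ((hf (k - 1) (by omega)).const_mul ((n : ℝ) + 1)).sub (hf 0 (by omega))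
    refine this.congr fun r => ?_
    unfold ht; push_cast; ring
  have hpos : ∀ᶠ r : ℕ in atTop, 0 < ht k n v r := by
    filter_upwards [hht.eventually (lt_mem_nhds hδ0), eventually_gt_atTop 0] with r hr hr0
    have h0 : (0 : ℝ) < r := by exact_mod_cast hr0
    have : (0 : ℝ) < ht k n v r := by
      rcases div_pos_iff.1 hr with h | h
      · exact h.1
      · linarith [h.2]
    exact_mod_cast this
  have hbd : ∃ b, ∀ r, b ≤ ht k n v r := by
    obtain ⟨N, hN⟩ := eventually_atTop.1 hpos
    refine ⟨-N, fun r => ?_⟩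
    by_cases h : N ≤ r
    · have := hN r h; omega
    · unfold ht
      have := digitCount_le v 0 r
      have : (0 : ℤ) ≤ ((n : ℤ) + 1) * (digitCount v (k - 1) r : ℤ) := by positivity
      omega
  set U : ℕ → ℕ := fun r => ((Finset.range r).filter fun s => v s = k - 1 ∧ unm k n v s).card with hUdef
  obtain ⟨C, hC⟩ := unm_count hk hz hbd U (fun r => rfl)
  choose hC1 S hS1 hS2 using hC
  have hSt : Tendsto S atTop atTop := tendsto_atTop_mono hS1 tendsto_id
  have hUC : Tendsto (fun r : ℕ => ((U r : ℝ) + C) / (r : ℝ)) atTop (𝓝 δ) := by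
    refine tendsto_of_tendsto_of_tendsto_of_le_of_le' (hht.comp hSt) hht ?_ ?_
    · filter_upwards [eventually_gt_atTop 0, hSt.eventually hpos] with r hr hp
      simp only [Function.comp]
      have e : (ht k n v (S r) : ℝ) = U r + C := by exact_mod_cast hS2 r
      rw [← e]
      have h0 : (0 : ℝ) < r := by exact_mod_cast hr
      have h1 : (r : ℝ) ≤ S r := by exact_mod_cast hS1 r
      have h2 : (0 : ℝ) ≤ ht k n v (S r) := by exact_mod_cast hp.le
      gcongr
    · refine Eventually.of_forall fun r => ?_
      have : (U r : ℝ) + C ≤ ht k n v r := by exact_mod_cast hC1 r r le_rfl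
      gcongr
  have hU : Tendsto (fun r : ℕ => (U r : ℝ) / (r : ℝ)) atTop (𝓝 δ) := by
    have := hUC.sub (tendsto_const_div_atTop_nhds_zero_nat (C : ℝ))
    rw [sub_zero] at this
    refine this.congr fun r => ?_
    ring
  -- frequencies of nonzero digits
  have hsum := HF_sum hv hf
  have hak : 0 < a (k - 1) := by
    have := HF_nonneg hf (show 0 < k by omega)
    by_contra hc
    push Not at hc
    have : ((n : ℝ) + 1) * a (k - 1) ≤ 0 := mul_nonpos_of_nonneg_of_nonpos (by positivity) hc
    linarith
  have ha0 : 0 < 1 - a 0 := by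
    have h2 : ∑ i ∈ ({0, k - 1} : Finset ℕ), a i ≤ ∑ i ∈ Finset.range k, a i := by
      apply Finset.sum_le_sum_of_subset_of_nonneg
      · intro i hi
        simp at hi ⊢; omega
      · intro i hi _
        exact HF_nonneg hf (Finset.mem_range.1 hi)
    rw [Finset.sum_pair (by omega), hsum] at h2
    linarith
  set cnt := Nat.count (fun r => v r ≠ 0) with hcnt
  have hcd : ∀ r, cnt r + digitCount v 0 r = r := by
    intro r
    induction r with
    | zero => simp [hcnt, digitCount_zero]
    | succ r ih =>
      rw [hcnt, Nat.count_succ, digitCount_succ]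
      rw [hcnt] at ih
      split_ifs <;> omega
  have hcl : Tendsto (fun r : ℕ => (cnt r : ℝ) / (r : ℝ)) atTop (𝓝 (1 - a 0)) := by
    have := (tendsto_const_nhds (x := (1 : ℝ))).sub (hf 0 (by omega))
    refine this.congr' ?_
    filter_upwards [eventually_gt_atTop 0] with r hr
    have h0 : (r : ℝ) ≠ 0 := by positivity
    have : (cnt r : ℝ) + digitCount v 0 r = r := by exact_mod_cast hcd r
    field_simp
    linarith
  have hct : Tendsto cnt atTop atTop := by
    have h1 : Tendsto (fun r : ℕ => (cnt r : ℝ)) atTop atTop := by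
      have := hcl.pos_mul_atTop ha0 (tendsto_natCast_atTop_atTop (R := ℝ))
      refine this.congr' ?_
      filter_upwards [eventually_gt_atTop 0] with r hr
      have h0 : (r : ℝ) ≠ 0 := by positivity
      rw [div_mul_cancel₀ _ h0]
    exact tendsto_natCast_atTop_iff.1 h1
  have hinf : {r | v r ≠ 0}.Infinite := by
    intro hfin
    obtain ⟨M, hM⟩ := hfin.bddAbove
    have : ∀ r, cnt (M + 1 + r) = cnt (M + 1) := by
      intro r
      induction r with
      | zero => rfl
      | succ r ih =>
        rw [← Nat.add_assoc, hcnt, Nat.count_succ, if_neg, Nat.add_zero]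
        · exact ih
        · intro h
          have := hM h
          omega
    obtain ⟨r, hr, hr'⟩ := ((hct.eventually_gt_atTop (cnt (M + 1))).and (eventually_ge_atTop (M + 1))).exists
    obtain ⟨j, rfl⟩ := Nat.exists_eq_add_of_le hr'
    have := this j
    omega
  set κ : ℕ → ℝ := fun e => if e + 2 < k then a (e + 1) else if e + 2 = k then a (k - 1) - δ else δ with hκ
  have hD : ∀ e < k, Tendsto (fun r : ℕ => (digitCount (des k n v) e (cnt r) : ℝ) / (r : ℝ)) atTop (𝓝 (κ e)) := by
    intro e he
    simp only [hcnt, des_digit, hκ]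
    rcases (show e + 2 < k ∨ e + 2 = k ∨ e + 1 = k by omega) with h | h | h
    · rw [if_pos h]
      refine (hf (e + 1) (by omega)).congr fun r => ?_
      unfold digitCount
      congr 3
      ext s
      simp only [Finset.mem_filter]
      refine and_congr_right fun _ => ?_
      unfold phd
      split_ifs <;> omega
    · rw [if_neg (by omega), if_pos h]
      refine ((hf (k - 1) (by omega)).sub hU).congr fun r => ?_
      have : (Finset.filter (fun s => v s = k - 1) (Finset.range r)).card =
          (Finset.filter (fun s => v s ≠ 0 ∧ phd k n v s = e) (Finset.range r)).card + U r := by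
        rw [hUdef, ← Finset.card_union_of_disjoint]
        · congr 1
          ext s
          have := hv s
          simp only [Finset.mem_filter, Finset.mem_union]
          unfold phd
          by_cases hu : unm k n v s
          · simp only [hu, if_true]
            split_ifs <;> grind
          · simp only [hu, if_false]
            split_ifs <;> grind
        · rw [Finset.disjoint_filter]
          rintro s _ ⟨h1, h2⟩ ⟨h3, h4⟩
          unfold phd at h2
          rw [if_pos h3, if_pos h4] at h2
          omega
      unfold digitCount
      rw [this]; push_cast; ring
    · rw [if_neg (by omega), if_neg (by omega)]
      refine hU.congr fun r => ?_
      simp only [hUdef]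
      congr 3
      ext s
      have := hv s
      simp only [Finset.mem_filter]
      refine and_congr_right fun _ => ?_
      unfold phd
      by_cases hu : unm k n v s
      · simp only [hu, if_true]
        split_ifs <;> grind
      · simp only [hu, if_false]
        split_ifs <;> grind
  have hcm : Monotone cnt := Nat.count_monotone _
  refine ⟨des k n v, fun e => κ e / (1 - a 0), des_insigma hk hv, fun j => ?_, fun e he => ?_, ha0, fun i hi => ?_⟩
  · set P := Nat.nth (fun r => v r ≠ 0) j with hPdef
    have hP0 : v P ≠ 0 := Nat.nth_mem_of_infinite hinf j
    have hPc : cnt P = j := Nat.count_nth_of_infinite hinf j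
    have hj : des k n v j = phd k n v P := rfl
    by_cases hh : des k n v j < k - 1
    · exact Or.inl (seqLe_of_head (by rwa [shift_iter_apply, Nat.zero_add, hs']))
    · have hu : unm k n v P := by
        by_contra hu
        rw [hj] at hh
        apply hh
        have := hv P
        unfold phd
        rw [if_neg hu]
        split_ifs <;> omega
      have := des_le hk hv hz (unm_clean hu)
      rw [← hcnt, hPc] at this
      exact lam_reflect hk n (insigma_shift (des_insigma hk hv) j) (seqLe_trans this (hX P))
  · exact freq_sample (fun x y h => digitCount_mono _ _ h) hcm (by simp [hcnt]) hct ha0 hcl (hD e he)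
  · have hne := ha0.ne'
    unfold Mn
    simp only [hκ]
    rw [if_neg (show ¬ (k - 2 + 2 < k) by omega), if_pos (show k - 2 + 2 = k by omega),
      if_neg (show ¬ (k - 1 + 2 < k) by omega), if_neg (show ¬ (k - 1 + 2 = k) by omega)]
    split_ifs with h1 h2 h3 h4
    · subst h1
      field_simp
      rw [hδ]; ring
    · rw [show i = k - 1 by omega]
      field_simp
      ring
    · rw [Nat.sub_add_cancel (by omega)]; field_simp
    · omega
    · omega

theorem lamList_base_head {k : ℕ} (hk : 3 ≤ k) (l : List ℕ) : lamList k l (baseSeq k) 0 = k - 1 := by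
  induction l with
  | nil => rfl
  | cons n t ih => exact lam_head_good hk ih

theorem upper {k : ℕ} (hk : 3 ≤ k) (l : List ℕ) : ∀ {v : Seq} {a : ℕ → ℝ}, InSigma k v →
    (∀ r, seqLe (shift^[r] v) (lamList k l (baseSeq k))) → HF k v a → InCone k l a := by
  induction l with
  | nil => intro v a hv hX hf; exact upper_base hk hX hf
  | cons n t ih =>
    intro v a hv hX hf
    by_cases hd : a 0 < ((n : ℝ) + 1) * a (k - 1)
    · obtain ⟨v', a', hv', hX', hf', h0, he⟩ := upper_step hk hv (lamList_base_head hk t) hX hf hd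
      refine ⟨0, fun i => (1 - a 0) * a' i, le_rfl, inCone_smul hk (ih hv' hX' hf') h0.le fun i _ => rfl, fun i hi => ?_⟩
      rw [he i hi]
      unfold Mn
      split_ifs <;> ring
    · push Not at hd
      exact inCone_easy hk n t (fun i hi => HF_nonneg hf hi) hd

/-! ### Conclusion -/

theorem HF_shift {k : ℕ} {v : Seq} {a : ℕ → ℝ} (h : HF k v a) : HF k (shift v) a := by
  intro i hi
  have h1 := div_shift (C := fun r => (digitCount v i r : ℝ)) (h i hi)
  have h2 := h1.sub (tendsto_const_div_atTop_nhds_zero_nat (digitCount v i 1 : ℝ))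
  rw [sub_zero] at h2
  refine h2.congr fun r => ?_
  have : digitCount v i (r + 1) = digitCount v i 1 + digitCount (shift v) i r := by
    rw [Nat.add_comm, digitCount_add]; rfl
  simp only [this]
  push_cast; ring

theorem part4 {k : ℕ} (hk : 3 ≤ k) (R : ℕ) (f : ℕ → ℕ) : ∃ V : Finset (E k),
      (∀ v ∈ V, v ∈ simplex k ∧ ∀ i : Fin k, ∃ q : ℚ, v i = (q : ℝ)) ∧
      ∀ β ∈ Iint k f R, DFbeta k β = convexHull ℝ (V : Set (E k)) := by
  set l := (List.range R).map f ++ [f R] with hl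
  obtain ⟨V, hV1, hV2⟩ := inCone_hull hk l
  refine ⟨V, hV1, fun β hβ => ?_⟩
  rw [mem_Iint hk] at hβ
  obtain ⟨h1, h2, hlo, hhi⟩ := hβ
  have hb := base_gt_one hk h1
  have elo : loS k ((List.range R).map f) (f R) = lamList k l (constSeq (k - 2)) := by
    rw [hl, lamList_append]; unfold loS; rw [lam_top_eq hk]; rfl
  have ehi : hiS k ((List.range R).map f) (f R) = lamList k l (baseSeq k) := by
    rw [hl, lamList_append]; rfl
  rw [elo] at hlo
  rw [ehi] at hhi
  ext α
  rw [hV2]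
  constructor
  · rintro ⟨hα, x, hx, hf⟩
    refine ⟨hα, ?_⟩
    have hf' : HF k (shift (dbeta β x)) (proj α) := HF_shift hf
    rw [dbeta_shift] at hf'
    have y0 : 0 ≤ fbeta β x := Int.fract_nonneg _
    have y1 : fbeta β x < 1 := Int.fract_lt_one _
    exact upper hk l (dbeta_insigma hb h2 y0 y1.le) (fun r => seqLe_trans (dbeta_le hb y0 y1 r) hhi) hf'
  · rintro ⟨hα, hcone⟩
    have hs : ∑ i ∈ Finset.range k, proj α i = 1 := by
      rw [Finset.sum_range, ← hα.2]
      exact Finset.sum_congr rfl fun i _ => proj_fin α i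
    obtain ⟨v, hv, hlt, hf⟩ := lower hk l hcone hs
    obtain ⟨x, hx, rfl⟩ := exists_point hk h1 h2 hv fun r => seqLt_of_lt_of_le (hlt r) hlo
    exact ⟨hα, x, hx, hf⟩

/-- the intervals `I_{n₀…n_R}` are mutually disjoint non-trivial closed
subintervals of `(k−1,k)` whose union has full Lebesgue measure, and on each of them
`DF(β)` is a constant polytope with rational vertices. -/
theorem stmt14 (k : ℕ) (hk : 3 ≤ k) :
    (∀ (R : ℕ) (f : ℕ → ℕ) (R' : ℕ) (f' : ℕ → ℕ),
      ¬ (R = R' ∧ ∀ i ≤ R, f i = f' i) → Disjoint (Iint k f R) (Iint k f' R')) ∧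
    (∀ (R : ℕ) (f : ℕ → ℕ), ∃ a b : ℝ,
      a < b ∧ (k : ℝ) - 1 < a ∧ b < (k : ℝ) ∧ Iint k f R = Set.Icc a b) ∧
    MeasureTheory.volume (Set.Ioo ((k : ℝ) - 1) (k : ℝ) \ ⋃ (R : ℕ) (f : ℕ → ℕ), Iint k f R) = 0 ∧
    (∀ (R : ℕ) (f : ℕ → ℕ), ∃ V : Finset (E k),
      (∀ v ∈ V, v ∈ simplex k ∧ ∀ i : Fin k, ∃ q : ℚ, v i = (q : ℝ)) ∧
      ∀ β ∈ Iint k f R, DFbeta k β = convexHull ℝ (V : Set (E k))) := by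
  exact ⟨part1 hk, part2 hk, part3 hk, part4 hk⟩

end BetaDF
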